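/- Uniqueness of classical solutions. Assume d > 0, δ > 0, f satisfies condition (f2), T ∈ (0,∞), and u₀ ∈ X(h₀). If (u₁, g₁, h₁) and (u₂, g₂, h₂) are both classical solutions of the free boundary problem (c) with the same initial datum u₀ on [0,T], then g₁(t) = g₂(t) and h₁(t) = h₂(t) for all t ∈ [0,T], and u₁(t,x) = u₂(t,x) for all t ∈ [0,T] and x ∈ [g₁(t), h₁(t)]. -/

import Mathlib

open Set Filter

/-- A function `f` is of Allee type `(f_A)` with distinguished zero `θ ∈ [0,1)`. -/
def AlleeType (f : ℝ → ℝ) (θ : ℝ) : Prop :=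
  ContDiffOn ℝ 1 f (Ici (0:ℝ)) ∧ θ ∈ Ico (0:ℝ) 1 ∧
    f 0 = 0 ∧ f θ = 0 ∧ f 1 = 0 ∧
    derivWithin f (Ici (0:ℝ)) 0 ≤ 0 ∧ derivWithin f (Ici (0:ℝ)) 1 < 0 ∧
    (∀ u ∈ Icc (0:ℝ) θ, f u ≤ 0) ∧ (∀ u ∈ Ioo θ (1:ℝ), 0 < f u) ∧
    (∀ u ∈ Ioi (1:ℝ), f u < 0) ∧ 0 < ∫ s in (0:ℝ)..1, f s

/-- `θs` is the number `θ*_f ∈ [θ,1)` attached to an Allee type `f`. -/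
def IsThetaStar (f : ℝ → ℝ) (θ θs : ℝ) : Prop :=
  θs ∈ Ico θ (1:ℝ) ∧ (∫ s in (0:ℝ)..θs, f s) = 0 ∧
    ∀ u ∈ Ioc θs (1:ℝ), 0 < ∫ s in (0:ℝ)..u, f s

/-- Membership in the initial class `X(h₀)`. -/
def InX (δ h₀ : ℝ) (φ : ℝ → ℝ) : Prop :=
  ContDiffOn ℝ 2 φ (Icc (-h₀) h₀) ∧ φ (-h₀) = δ ∧ φ h₀ = δ ∧
    ∀ x ∈ Icc (-h₀) h₀, 0 < φ x

/-- A classical solution `(u,g,h)` of the free boundary problem (with reaction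
term `f = f(t,x,u)`) with initial datum `u₀ ∈ X(h₀)` on the time interval `I`. -/
structure ClassicalSolution (d δ h₀ : ℝ) (f : ℝ → ℝ → ℝ → ℝ) (u₀ : ℝ → ℝ)
    (I : Set ℝ) (u : ℝ → ℝ → ℝ) (g h : ℝ → ℝ) : Prop where
  g_reg : ContDiffOn ℝ 1 g I
  h_reg : ContDiffOn ℝ 1 h I
  g_lt_h : ∀ t ∈ I, g t < h t
  u_cont : ContinuousOn (fun p : ℝ × ℝ => u p.1 p.2)
      {p : ℝ × ℝ | p.1 ∈ I ∧ p.2 ∈ Icc (g p.1) (h p.1)}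
  ux_cont : ContinuousOn (fun p : ℝ × ℝ => deriv (u p.1) p.2)
      {p : ℝ × ℝ | p.1 ∈ I ∧ 0 < p.1 ∧ p.2 ∈ Icc (g p.1) (h p.1)}
  ut_diff : ∀ t ∈ I, 0 < t → ∀ x ∈ Ioo (g t) (h t),
      DifferentiableAt ℝ (fun s => u s x) t
  ux_diff : ∀ t ∈ I, 0 < t → ∀ x ∈ Icc (g t) (h t), DifferentiableAt ℝ (u t) x
  uxx_diff : ∀ t ∈ I, 0 < t → ∀ x ∈ Ioo (g t) (h t),
      DifferentiableAt ℝ (deriv (u t)) x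
  ut_cont : ContinuousOn (fun p : ℝ × ℝ => deriv (fun s => u s p.2) p.1)
      {p : ℝ × ℝ | p.1 ∈ I ∧ 0 < p.1 ∧ p.2 ∈ Ioo (g p.1) (h p.1)}
  uxx_cont : ContinuousOn (fun p : ℝ × ℝ => deriv (deriv (u p.1)) p.2)
      {p : ℝ × ℝ | p.1 ∈ I ∧ 0 < p.1 ∧ p.2 ∈ Ioo (g p.1) (h p.1)}
  pde : ∀ t ∈ I, 0 < t → ∀ x ∈ Ioo (g t) (h t),
      deriv (fun s => u s x) t = d * deriv (deriv (u t)) x + f t x (u t x)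
  bc_g : ∀ t ∈ I, 0 < t → u t (g t) = δ
  bc_h : ∀ t ∈ I, 0 < t → u t (h t) = δ
  stefan_g : ∀ t ∈ I, 0 < t → deriv g t = -(d / δ) * deriv (u t) (g t)
  stefan_h : ∀ t ∈ I, 0 < t → deriv h t = -(d / δ) * deriv (u t) (h t)
  g_init : g 0 = -h₀
  h_init : h 0 = h₀
  u_init : ∀ x ∈ Icc (-h₀) h₀, u 0 x = u₀ x

/-- A semi-wave pair `(c,q)` for `(f, δ, d)`. -/
def SemiWavePair (d δ : ℝ) (f : ℝ → ℝ) (c : ℝ) (q : ℝ → ℝ) : Prop :=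
  0 < c ∧ ContDiffOn ℝ 2 q (Ici (0:ℝ)) ∧
    (∀ z ∈ Ici (0:ℝ),
      d * derivWithin (derivWithin q (Ici (0:ℝ))) (Ici (0:ℝ)) z
        - c * derivWithin q (Ici (0:ℝ)) z + f (q z) = 0) ∧
    (∀ z ∈ Ioi (0:ℝ), 0 < q z) ∧ q 0 = δ ∧
    Tendsto q atTop (nhds 1) ∧
    derivWithin q (Ici (0:ℝ)) 0 = c * δ / d ∧
    ∀ z ∈ Ici (0:ℝ), 0 < derivWithin q (Ici (0:ℝ)) z

/-- Condition `(f2)` with Hölder exponent `β`. -/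
def CondF2 (f : ℝ → ℝ → ℝ → ℝ) (β : ℝ) : Prop :=
  β ∈ Ioo (0:ℝ) 1 ∧
    (∀ M > 0, ∃ C > 0, ∀ t₁ ∈ Ici (0:ℝ), ∀ t₂ ∈ Ici (0:ℝ), ∀ x₁ x₂ : ℝ,
        ∀ v ∈ Icc (0:ℝ) M,
        |f t₁ x₁ v - f t₂ x₂ v| ≤ C * (|t₁ - t₂| ^ (β / 2) + |x₁ - x₂| ^ β)) ∧
    (∀ t ∈ Ici (0:ℝ), ∀ x : ℝ, ContDiffOn ℝ 1 (f t x) (Ici (0:ℝ))) ∧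
    (∀ t ∈ Ici (0:ℝ), ∀ x : ℝ, f t x 0 = 0) ∧
    (∀ M > 0, ∃ L > 0, ∀ t ∈ Ici (0:ℝ), ∀ x : ℝ,
        ∀ v₁ ∈ Icc (0:ℝ) M, ∀ v₂ ∈ Icc (0:ℝ) M,
        |f t x v₁ - f t x v₂| ≤ L * |v₁ - v₂|)

/-- Condition `(f3)` with constant `M₀`. -/
def CondF3 (f : ℝ → ℝ → ℝ → ℝ) (M₀ : ℝ) : Prop :=
  0 < M₀ ∧ ∀ t ∈ Ici (0:ℝ), ∀ x : ℝ, ∀ v, M₀ ≤ v → f t x v < 0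

/-- Part (i) of condition `(f4)`, with upper bound function `fbar`. -/
def CondF4i (f : ℝ → ℝ → ℝ → ℝ) (fbar : ℝ → ℝ) (β : ℝ) : Prop :=
  CondF2 f β ∧ (∀ t ∈ Ici (0:ℝ), ∀ x : ℝ, f t x 1 = 0) ∧
    ContinuousOn fbar (Ici (1:ℝ)) ∧
    ∀ t ∈ Ici (0:ℝ), ∀ x : ℝ, ∀ v, 1 < v → f t x v ≤ fbar v ∧ fbar v < 0

/-- Condition `(f4)`, with bounds `fbar` (above, for `u > 1`) and
`funder` (below, of Allee type). -/
def CondF4 (f : ℝ → ℝ → ℝ → ℝ) (fbar funder : ℝ → ℝ) (θ β : ℝ) : Prop :=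
  CondF4i f fbar β ∧ AlleeType funder θ ∧
    ∀ t ∈ Ici (0:ℝ), ∀ x : ℝ, ∀ v, 0 ≤ v → funder v ≤ f t x v

/-- Combustion-type nonlinearity `(f_c)` with ignition value `θ`. -/
def CombustionType (f : ℝ → ℝ) (θ : ℝ) : Prop :=
  ContDiffOn ℝ 1 f (Ici (0:ℝ)) ∧ θ ∈ Ioo (0:ℝ) 1 ∧
    (∀ u ∈ Icc (0:ℝ) θ, f u = 0) ∧ f 1 = 0 ∧ derivWithin f (Ici (0:ℝ)) 1 < 0 ∧
    (∀ u ∈ Ioo θ (1:ℝ), 0 < f u) ∧ (∀ u ∈ Ioi (1:ℝ), f u < 0)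

/-- The (unnormalised) bistable condition `(F_b)` with constants `0 < P < Q`. -/
def CondFb (F : ℝ → ℝ) (P Q : ℝ) : Prop :=
  0 < P ∧ P < Q ∧ ContDiffOn ℝ 1 F (Ici (0:ℝ)) ∧
    F 0 = 0 ∧ F P = 0 ∧ F Q = 0 ∧
    derivWithin F (Ici (0:ℝ)) 0 < 0 ∧ derivWithin F (Ici (0:ℝ)) Q < 0 ∧
    (∀ u ∈ Ioo (0:ℝ) P, F u < 0) ∧ (∀ u ∈ Ioi Q, F u < 0) ∧
    (∀ u ∈ Ioo P Q, 0 < F u) ∧ 0 < ∫ s in (0:ℝ)..Q, F s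


/-- second derivative test: necessary condition at a local minimum -/
lemma aux_second_deriv {w wx : ℝ → ℝ} {x wxx : ℝ} (hmin : IsLocalMin w x)
    (h1 : ∀ᶠ y in nhds x, HasDerivAt w (wx y) y) (h2 : HasDerivAt wx wxx x) : 0 ≤ wxx := by
  by_contra hneg
  push Not at hneg
  have hE : deriv w =ᶠ[nhds x] wx := h1.mono fun y hy => hy.deriv
  have hdd : deriv (deriv w) x = wxx := by
    rw [hE.deriv_eq]; exact h2.deriv
  have hmax : IsLocalMax w x :=
    isLocalMax_of_deriv_deriv_neg (by rw [hdd]; exact hneg) hmin.deriv_eq_zero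
      h1.self_of_nhds.continuousAt
  have hc : w =ᶠ[nhds x] fun _ => w x := by
    filter_upwards [hmin, hmax] with y ha hb using le_antisymm hb ha
  have h0 : deriv w =ᶠ[nhds x] fun _ => 0 := by
    have := hc.deriv
    simpa using this
  have : deriv (deriv w) x = 0 := by rw [h0.deriv_eq]; simp
  linarith

/-- left derivative at a left-local minimum is nonpositive -/
lemma aux_left_deriv {v : ℝ → ℝ} {t v' : ℝ} (hv : HasDerivAt v v' t)
    (hmin : ∀ᶠ s in nhdsWithin t (Iio t), v t ≤ v s) : v' ≤ 0 := by
  have h := (hasDerivAt_iff_tendsto_slope.1 hv).mono_left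
    (nhdsWithin_mono t (fun s (hs : s ∈ Iio t) => ne_of_lt hs))
  refine le_of_tendsto h ?_
  filter_upwards [hmin, self_mem_nhdsWithin] with s hs hs'
  rw [slope_def_field]
  exact div_nonpos_of_nonneg_of_nonpos (by linarith) (by have : s < t := hs'; linarith)

/-- compactness of the region between two continuous curves -/
lemma aux_region_compact {t0 t1 : ℝ} {γ η : ℝ → ℝ} (hγ : ContinuousOn γ (Icc t0 t1))
    (hη : ContinuousOn η (Icc t0 t1)) :
    IsCompact {p : ℝ × ℝ | p.1 ∈ Icc t0 t1 ∧ p.2 ∈ Icc (γ p.1) (η p.1)} := by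
  obtain ⟨A, hA⟩ := (isCompact_Icc.image_of_continuousOn hγ).bddBelow
  obtain ⟨B, hB⟩ := (isCompact_Icc.image_of_continuousOn hη).bddAbove
  have hs : IsClosed {p : ℝ × ℝ | p.1 ∈ Icc t0 t1} := isClosed_Icc.preimage continuous_fst
  have hm : MapsTo (Prod.fst : ℝ × ℝ → ℝ) {p : ℝ × ℝ | p.1 ∈ Icc t0 t1} (Icc t0 t1) :=
    fun p hp => hp
  have c1 := hs.isClosed_le (hγ.comp continuousOn_fst hm) (continuousOn_snd)
  have c2 := c1.isClosed_le (f := Prod.snd) (g := fun p => η p.1) continuousOn_snd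
    ((hη.comp continuousOn_fst hm).mono (fun p hp => hp.1))
  refine IsCompact.of_isClosed_subset ((isCompact_Icc (a := t0) (b := t1)).prod (isCompact_Icc (a := A) (b := B)))
     ?_ ?_
  · convert c2 using 1
    ext p
    simp only [mem_ofPred_eq, mem_Icc, Function.comp]
    tauto
  · rintro p ⟨hp, hp2⟩
    exact ⟨hp, (hA ⟨p.1, hp, rfl⟩).trans hp2.1, hp2.2.trans (hB ⟨p.1, hp, rfl⟩)⟩

/-- weak maximum principle on a region between two curves -/
lemma aux_max_principle {d L t0 t1 : ℝ} {γ η : ℝ → ℝ} {w : ℝ → ℝ → ℝ} (hd : 0 < d)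
    (hγ : ContinuousOn γ (Icc t0 t1)) (hη : ContinuousOn η (Icc t0 t1))
    (hw : ContinuousOn (fun p : ℝ × ℝ => w p.1 p.2)
      {p : ℝ × ℝ | p.1 ∈ Icc t0 t1 ∧ p.2 ∈ Icc (γ p.1) (η p.1)})
    (hi : ∀ x ∈ Icc (γ t0) (η t0), 0 ≤ w t0 x)
    (hbγ : ∀ t ∈ Icc t0 t1, γ t ≤ η t → 0 ≤ w t (γ t))
    (hbη : ∀ t ∈ Icc t0 t1, γ t ≤ η t → 0 ≤ w t (η t))
    (hint : ∀ t ∈ Ioc t0 t1, ∀ x ∈ Ioo (γ t) (η t), w t x < 0 →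
      ∃ (wt wxx : ℝ) (wx : ℝ → ℝ), HasDerivAt (fun s => w s x) wt t ∧
        (∀ᶠ y in nhds x, HasDerivAt (w t) (wx y) y) ∧ HasDerivAt wx wxx x ∧
        d * wxx + L * w t x ≤ wt) :
    ∀ t ∈ Icc t0 t1, ∀ x ∈ Icc (γ t) (η t), 0 ≤ w t x := by
  intro t ht x hx
  by_contra hneg
  push Not at hneg
  have hK := aux_region_compact hγ hη
  set K := {p : ℝ × ℝ | p.1 ∈ Icc t0 t1 ∧ p.2 ∈ Icc (γ p.1) (η p.1)} with hKdef
  have hcont : ContinuousOn (fun p : ℝ × ℝ => Real.exp (-(L+1) * p.1) * w p.1 p.2) K :=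
    (by fun_prop : Continuous fun p : ℝ × ℝ => Real.exp (-(L+1) * p.1)).continuousOn.mul hw
  obtain ⟨⟨s, y⟩, ⟨hs, hy⟩, hm⟩ := hK.exists_isMinOn ⟨(t, x), ht, hx⟩ hcont
  simp only at hs hy
  have hval : Real.exp (-(L+1) * s) * w s y < 0 := by
    have := hm (show (t, x) ∈ K from ⟨ht, hx⟩)
    simp only [mem_ofPred_eq] at this
    exact lt_of_le_of_lt this (mul_neg_of_pos_of_neg (Real.exp_pos _) hneg)
  have hwneg : w s y < 0 := by
    by_contra h; push Not at h
    exact absurd hval (not_lt.2 (mul_nonneg (Real.exp_pos _).le h))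
  have hle : γ s ≤ η s := hy.1.trans hy.2
  have hs0 : t0 < s := by
    rcases hs.1.eq_or_lt with h | h
    · subst h; exact absurd (hi y hy) (not_le.2 hwneg)
    · exact h
  have hy1 : γ s < y := by
    rcases hy.1.eq_or_lt with h | h
    · have := hbγ s hs hle
      rw [h] at this; exact absurd this (not_le.2 hwneg)
    · exact h
  have hy2 : y < η s := by
    rcases hy.2.eq_or_lt with h | h
    · have := hbη s hs hle
      rw [← h] at this; exact absurd this (not_le.2 hwneg)
    · exact h
  obtain ⟨wt, wxx, wx, hwt, hwx, hwxx, hineq⟩ := hint s ⟨hs0, hs.2⟩ y ⟨hy1, hy2⟩ hwneg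
  have hxx : 0 ≤ wxx := by
    refine aux_second_deriv (w := w s) ?_ hwx hwxx
    filter_upwards [Ioo_mem_nhds hy1 hy2] with z hz
    have := hm (show (s, z) ∈ K from ⟨hs, hz.1.le, hz.2.le⟩)
    simp only [mem_ofPred_eq] at this
    exact le_of_mul_le_mul_left this (Real.exp_pos _)
  have hvt : HasDerivAt (fun r => Real.exp (-(L+1) * r) * w r y)
      (Real.exp (-(L+1) * s) * (-(L+1)) * w s y + Real.exp (-(L+1) * s) * wt) s := by
    have h1 : HasDerivAt (fun r => Real.exp (-(L+1) * r)) (Real.exp (-(L+1) * s) * (-(L+1))) s := by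
      have := ((hasDerivAt_id s).const_mul (-(L+1))).exp
      simpa using this
    exact h1.mul hwt
  have hnp := aux_left_deriv hvt (by
    have hsub : nhdsWithin s (Iio s) ≤ nhdsWithin s (Icc t0 t1) := by
      rw [← nhdsWithin_Ioo_eq_nhdsLT hs0]
      exact nhdsWithin_mono _ (fun r hr => ⟨hr.1.le, hr.2.le.trans hs.2⟩)
    have e1 : ∀ᶠ r in nhdsWithin s (Iio s), γ r < y :=
      ((hγ s hs).mono_left hsub).eventually (gt_mem_nhds hy1)
    have e2 : ∀ᶠ r in nhdsWithin s (Iio s), y < η r :=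
      ((hη s hs).mono_left hsub).eventually (lt_mem_nhds hy2)
    have e3 : ∀ᶠ r in nhdsWithin s (Iio s), r ∈ Icc t0 t1 := hsub self_mem_nhdsWithin
    filter_upwards [e1, e2, e3] with r h1 h2 h3
    exact hm (show (r, y) ∈ K from ⟨h3, h1.le, h2.le⟩))
  have h3 : Real.exp (-(L+1) * s) * (wt - (L+1) * w s y) ≤ 0 := by linarith
  have h4 : wt - (L+1) * w s y ≤ 0 := by
    by_contra h; push Not at h
    exact absurd h3 (not_le.2 (mul_pos (Real.exp_pos _) h))
  nlinarith [mul_nonneg hd.le hxx]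

section basics
variable {d δ h₀ T : ℝ} {f : ℝ → ℝ → ℝ → ℝ} {u₀ : ℝ → ℝ} {u : ℝ → ℝ → ℝ} {g h : ℝ → ℝ}

lemma aux_bc (hu₀ : InX δ h₀ u₀) (hh₀ : 0 < h₀)
    (hsol : ClassicalSolution d δ h₀ f u₀ (Icc 0 T) u g h) :
    ∀ t ∈ Icc 0 T, u t (g t) = δ ∧ u t (h t) = δ := by
  intro t ht
  rcases ht.1.eq_or_lt with h0 | h0
  · subst h0
    rw [hsol.g_init, hsol.h_init, hsol.u_init _ ⟨le_rfl, by linarith⟩,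
      hsol.u_init _ ⟨by linarith, le_rfl⟩]
    exact ⟨hu₀.2.1, hu₀.2.2.1⟩
  · exact ⟨hsol.bc_g t ht h0, hsol.bc_h t ht h0⟩

lemma aux_data (hsol : ClassicalSolution d δ h₀ f u₀ (Icc 0 T) u g h)
    {t x : ℝ} (ht : t ∈ Icc 0 T) (h0 : 0 < t) (hx : x ∈ Ioo (g t) (h t)) :
    ∃ ut uxx, HasDerivAt (fun s => u s x) ut t ∧
      (∀ᶠ y in nhds x, HasDerivAt (u t) (deriv (u t) y) y) ∧
      HasDerivAt (deriv (u t)) uxx x ∧ ut = d * uxx + f t x (u t x) := by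
  refine ⟨_, _, (hsol.ut_diff t ht h0 x hx).hasDerivAt, ?_,
    (hsol.uxx_diff t ht h0 x hx).hasDerivAt, hsol.pde t ht h0 x hx⟩
  filter_upwards [Ioo_mem_nhds hx.1 hx.2] with y hy
  exact (hsol.ux_diff t ht h0 y ⟨hy.1.le, hy.2.le⟩).hasDerivAt

lemma aux_bound (hsol : ClassicalSolution d δ h₀ f u₀ (Icc 0 T) u g h) :
    ∃ M > 0, ∀ t ∈ Icc 0 T, ∀ x ∈ Icc (g t) (h t), |u t x| ≤ M := by
  obtain ⟨C, hC⟩ := (aux_region_compact hsol.g_reg.continuousOn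
    hsol.h_reg.continuousOn).exists_bound_of_continuousOn hsol.u_cont
  refine ⟨|C| + 1, by positivity, fun t ht x hx => ?_⟩
  have := hC (t, x) ⟨ht, hx⟩
  rw [Real.norm_eq_abs] at this
  exact this.trans ((le_abs_self C).trans (by linarith))

lemma aux_pos {β : ℝ} (hd : 0 < d) (hδ : 0 < δ) (hh₀ : 0 < h₀) (hf2 : CondF2 f β)
    (hu₀ : InX δ h₀ u₀) (hsol : ClassicalSolution d δ h₀ f u₀ (Icc 0 T) u g h) :
    ∀ t ∈ Icc 0 T, ∀ x ∈ Icc (g t) (h t), 0 ≤ u t x := by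
  intro t ht x hx
  by_contra hneg
  push Not at hneg
  obtain ⟨M, hM, hMb⟩ := aux_bound hsol
  obtain ⟨L, hL, hLip⟩ := hf2.2.2.2.2 M hM
  have hbc := aux_bc hu₀ hh₀ hsol
  obtain ⟨m, hm, hm0, hmδ⟩ : ∃ m > 0, (∀ z ∈ Icc (-h₀) h₀, m ≤ u₀ z) ∧ m ≤ δ := by
    obtain ⟨z, hz, hzm⟩ := (isCompact_Icc (a := -h₀) (b := h₀)).exists_isMinOn
      ⟨h₀, by constructor <;> linarith⟩ hu₀.1.continuousOn
    refine ⟨min (u₀ z) δ, lt_min (hu₀.2.2.2 z hz) hδ, fun y hy => ?_, min_le_right _ _⟩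
    exact (min_le_left _ _).trans (hzm hy)
  have hK := aux_region_compact hsol.g_reg.continuousOn hsol.h_reg.continuousOn
  have hZ := hsol.u_cont.preimage_isClosed_of_isClosed hK.isClosed (isClosed_Iic (a := (0:ℝ)))
  have hZc := hK.of_isClosed_subset hZ inter_subset_left
  obtain ⟨⟨s, y⟩, ⟨⟨hs, hy⟩, hsy⟩, hmin⟩ := hZc.exists_isMinOn ⟨(t, x), ⟨ht, hx⟩, hneg.le⟩
    continuousOn_fst
  simp only [mem_preimage, mem_Iic] at hs hy hsy
  have hlt : ∀ r ∈ Icc 0 T, r < s → ∀ z ∈ Icc (g r) (h r), 0 < u r z := by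
    intro r hr hrs z hz
    by_contra hc
    push Not at hc
    have := hmin (show (r, z) ∈ _ from ⟨⟨hr, hz⟩, hc⟩)
    simp only [mem_ofPred_eq] at this
    linarith
  have hs0 : 0 < s := by
    rcases hs.1.eq_or_lt with h' | h'
    · subst h'
      rw [hsol.g_init, hsol.h_init] at hy
      rw [hsol.u_init y hy] at hsy
      linarith [hm0 y hy]
    · exact h'
  have hy1 : g s < y := by
    rcases hy.1.eq_or_lt with h' | h'
    · rw [← h', (hbc s hs).1] at hsy; linarith
    · exact h'
  have hy2 : y < h s := by
    rcases hy.2.eq_or_lt with h' | h'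
    · rw [h', (hbc s hs).2] at hsy; linarith
    · exact h'
  have key : ∀ r ∈ Ico 0 s, ∀ z ∈ Icc (g r) (h r), m * Real.exp (-L * r) ≤ u r z := by
    intro r hr
    have hsub : Icc 0 r ⊆ Icc 0 T := Icc_subset_Icc_right (hr.2.le.trans hs.2)
    have hmle : ∀ q, 0 ≤ q → m * Real.exp (-L * q) ≤ m := by
      intro q hq
      have : Real.exp (-L * q) ≤ 1 := Real.exp_le_one_iff.2 (by nlinarith)
      nlinarith
    have := aux_max_principle (d := d) (L := L) (t0 := 0) (t1 := r) (γ := g) (η := h)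
      (w := fun q z => u q z - m * Real.exp (-L * q)) hd
      (hsol.g_reg.continuousOn.mono hsub) (hsol.h_reg.continuousOn.mono hsub)
      ((hsol.u_cont.mono (fun p hp => ⟨hsub hp.1, hp.2⟩)).sub
        (by fun_prop : Continuous fun p : ℝ × ℝ => m * Real.exp (-L * p.1)).continuousOn)
      ?_ ?_ ?_ ?_
    · intro z hz
      have := this r ⟨hr.1, le_rfl⟩ z hz
      linarith
    · intro z hz
      rw [hsol.g_init, hsol.h_init] at hz
      rw [hsol.u_init z hz]
      linarith [hm0 z hz, hmle 0 le_rfl]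
    · intro q hq _
      rw [(hbc q (hsub hq)).1]
      linarith [hmle q hq.1]
    · intro q hq _
      rw [(hbc q (hsub hq)).2]
      linarith [hmle q hq.1]
    · intro q hq z hz hw
      have hqT := hsub ⟨hq.1.le, hq.2⟩
      have hzI : z ∈ Icc (g q) (h q) := ⟨hz.1.le, hz.2.le⟩
      obtain ⟨ut, uxx, h1, h2, h3, h4⟩ := aux_data hsol hqT hq.1 hz
      refine ⟨ut - m * (Real.exp (-L * q) * (-L)), uxx, deriv (u q), ?_, ?_, h3, ?_⟩
      · have e1 : HasDerivAt (fun r => Real.exp (-L * r)) (Real.exp (-L * q) * (-L)) q := by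
          have := ((hasDerivAt_id q).const_mul (-L)).exp
          simpa using this
        exact h1.sub (e1.const_mul m)
      · filter_upwards [h2] with v hv using hv.sub_const _
      · have hp := hlt q hqT (lt_of_le_of_lt hq.2 hr.2) z hzI
        have hb := hMb q hqT z hzI
        have hf := hLip q hqT.1 z (u q z) ⟨hp.le, (le_abs_self _).trans hb⟩ 0 ⟨le_rfl, hM.le⟩
        rw [hf2.2.2.2.1 q hqT.1 z, sub_zero, sub_zero, abs_of_pos hp] at hf
        have hf' := (abs_le.1 hf).1
        rw [h4]
        nlinarith
  have hsub : nhdsWithin s (Iio s) ≤ nhdsWithin s (Icc 0 T) := by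
    rw [← nhdsWithin_Ioo_eq_nhdsLT hs0]
    exact nhdsWithin_mono _ (fun r hr => ⟨hr.1.le, hr.2.le.trans hs.2⟩)
  have e1 : ∀ᶠ r in nhdsWithin s (Iio s), g r < y :=
    ((hsol.g_reg.continuousOn s hs).mono_left hsub).eventually (gt_mem_nhds hy1)
  have e2 : ∀ᶠ r in nhdsWithin s (Iio s), y < h r :=
    ((hsol.h_reg.continuousOn s hs).mono_left hsub).eventually (lt_mem_nhds hy2)
  have e3 : ∀ᶠ r in nhdsWithin s (Iio s), r ∈ Ico 0 s := by
    rw [← nhdsWithin_Ioo_eq_nhdsLT hs0]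
    filter_upwards [self_mem_nhdsWithin] with r hr using ⟨hr.1.le, hr.2⟩
  have tl : Tendsto (fun r => u r y) (nhdsWithin s (Iio s)) (nhds (u s y)) := by
    have := (hsol.ut_diff s hs hs0 y ⟨hy1, hy2⟩).continuousAt
    exact this.tendsto.mono_left nhdsWithin_le_nhds
  have : m * Real.exp (-L * s) ≤ u s y := by
    refine ge_of_tendsto tl ?_
    filter_upwards [e1, e2, e3] with r h1 h2 h3
    refine le_trans ?_ (key r h3 y ⟨h1.le, h2.le⟩)
    have : Real.exp (-L * s) ≤ Real.exp (-L * r) := Real.exp_le_exp.2 (by nlinarith [h3.2])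
    nlinarith
  have : 0 < m * Real.exp (-L * s) := by positivity
  linarith

end basics

section bdry
variable {d δ h₀ T : ℝ} {f : ℝ → ℝ → ℝ → ℝ} {u₀ : ℝ → ℝ} {u : ℝ → ℝ → ℝ} {g h : ℝ → ℝ}

lemma aux_deriv_bound {ξ : ℝ → ℝ} (hT : 0 < T) (hξ : ContDiffOn ℝ 1 ξ (Icc 0 T)) :
    ∃ B ≥ 0, ∀ t ∈ Ioo 0 T, HasDerivAt ξ (deriv ξ t) t ∧ |deriv ξ t| ≤ B := by
  have hc := hξ.continuousOn_derivWithin (uniqueDiffOn_Icc hT) le_rfl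
  obtain ⟨B, hB⟩ := isCompact_Icc.exists_bound_of_continuousOn hc
  refine ⟨|B|, abs_nonneg _, fun t ht => ?_⟩
  have hn : Icc 0 T ∈ nhds t := Icc_mem_nhds ht.1 ht.2
  have hdiff : DifferentiableAt ℝ ξ t :=
    (hξ.differentiableOn (by simp) t ⟨ht.1.le, ht.2.le⟩).differentiableAt hn
  refine ⟨hdiff.hasDerivAt, ?_⟩
  have := hB t ⟨ht.1.le, ht.2.le⟩
  rw [derivWithin_of_mem_nhds hn, Real.norm_eq_abs] at this
  exact this.trans (le_abs_self _)

lemma aux_init_lip (hh₀ : 0 < h₀) (hu₀ : InX δ h₀ u₀) :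
    ∃ K0 ≥ 0, ∀ x ∈ Icc (-h₀) h₀, ∀ y ∈ Icc (-h₀) h₀, |u₀ x - u₀ y| ≤ K0 * |x - y| := by
  have hlt : -h₀ < h₀ := by linarith
  have hc := hu₀.1.continuousOn_derivWithin (uniqueDiffOn_Icc hlt) (by norm_num)
  obtain ⟨B, hB⟩ := isCompact_Icc.exists_bound_of_continuousOn hc
  refine ⟨|B|, abs_nonneg _, fun x hx y hy => ?_⟩
  have := (convex_Icc (-h₀) h₀).norm_image_sub_le_of_norm_derivWithin_le
    (hu₀.1.differentiableOn (by norm_num)) (C := |B|)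
    (fun z hz => (hB z hz).trans (le_abs_self _)) hy hx
  simpa [Real.norm_eq_abs] using this

/-- barrier estimate at a boundary curve -/
lemma aux_barrier (hd : 0 < d) (hh₀ : 0 < h₀) (hT : 0 < T)
    (hu₀ : InX δ h₀ u₀) (hsol : ClassicalSolution d δ h₀ f u₀ (Icc 0 T) u g h)
    {F0 : ℝ} (hF : ∀ t ∈ Icc 0 T, ∀ x ∈ Icc (g t) (h t), |f t x (u t x)| ≤ F0)
    {ξ : ℝ → ℝ} {σ : ℝ} (hσ : σ = 1 ∨ σ = -1) (hξ : ContDiffOn ℝ 1 ξ (Icc 0 T))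
    (hξ0 : ξ 0 ∈ Icc (-h₀) h₀) (hξδ : u₀ (ξ 0) = δ)
    (hside : ∀ t ∈ Icc 0 T, ∀ x ∈ Icc (g t) (h t), 0 ≤ σ * (ξ t - x)) :
    ∃ K ≥ 0, ∀ t ∈ Ico 0 T, ∀ x ∈ Icc (g t) (h t), |u t x - δ| ≤ K * |ξ t - x| := by
  have hbc := aux_bc hu₀ hh₀ hsol
  obtain ⟨B, hB0, hB⟩ := aux_deriv_bound hT hξ
  obtain ⟨K0, hK00, hK0⟩ := aux_init_lip hh₀ hu₀
  have hF0 : 0 ≤ F0 := by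
    have h0 : (0:ℝ) ∈ Icc 0 T := ⟨le_rfl, hT.le⟩
    exact (abs_nonneg _).trans (hF 0 h0 (g 0) ⟨le_rfl, (hsol.g_lt_h 0 h0).le⟩)
  have hσ2 : σ * σ = 1 := by rcases hσ with h | h <;> rw [h] <;> norm_num
  have hσa : |σ| = 1 := by rcases hσ with h | h <;> rw [h] <;> norm_num
  have habs : ∀ t ∈ Icc 0 T, ∀ x ∈ Icc (g t) (h t), σ * (ξ t - x) = |ξ t - x| := by
    intro t ht x hx
    rw [← abs_of_nonneg (hside t ht x hx), abs_mul, hσa, one_mul]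
  have hK := aux_region_compact hsol.g_reg.continuousOn hsol.h_reg.continuousOn
  have hξc : ContinuousOn (fun p : ℝ × ℝ => ξ p.1)
      {p : ℝ × ℝ | p.1 ∈ Icc 0 T ∧ p.2 ∈ Icc (g p.1) (h p.1)} :=
    hξ.continuousOn.comp continuousOn_fst (fun p hp => hp.1)
  obtain ⟨R, hR⟩ := hK.exists_bound_of_continuousOn (hξc.sub continuousOn_snd)
  have hR' : ∀ t ∈ Icc 0 T, ∀ x ∈ Icc (g t) (h t), σ * (ξ t - x) ≤ R := by
    intro t ht x hx
    rw [habs t ht x hx]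
    exact hR (t, x) ⟨ht, hx⟩
  set k := (B + 1) / d with hk
  have hkpos : 0 < k := by positivity
  have hdk : d * k = B + 1 := by rw [hk]; field_simp
  set q := Real.exp (-(k * R)) with hq
  have hqpos : 0 < q := Real.exp_pos _
  set A := (K0 + F0) / (k * q) with hA
  have hA0 : 0 ≤ A := by positivity
  have hAkq : A * k * q = K0 + F0 := by rw [hA]; field_simp
  refine ⟨A * k, by positivity, ?_⟩
  have key : ∀ s : ℝ, (s = 1 ∨ s = -1) → ∀ t1 ∈ Ico 0 T, ∀ x ∈ Icc (g t1) (h t1),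
      s * (u t1 x - δ) ≤ A * (1 - Real.exp (-(k * (σ * (ξ t1 - x))))) := by
    intro s hs t1 ht1
    have hsa : |s| = 1 := by rcases hs with h | h <;> rw [h] <;> norm_num
    have hsub : Icc 0 t1 ⊆ Icc 0 T := Icc_subset_Icc_right ht1.2.le
    have hb : ∀ t ∈ Icc 0 t1, ∀ x ∈ Icc (g t) (h t), u t x = δ →
        0 ≤ A * (1 - Real.exp (-(k * (σ * (ξ t - x))))) - s * (u t x - δ) := by
      intro t ht x hx hu
      rw [hu, sub_self, mul_zero, sub_zero]
      have : Real.exp (-(k * (σ * (ξ t - x)))) ≤ 1 := Real.exp_le_one_iff.2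
        (neg_nonpos.2 (mul_nonneg hkpos.le (hside t (hsub ht) x hx)))
      exact mul_nonneg hA0 (by linarith)
    have := aux_max_principle (d := d) (L := 0) (t0 := 0) (t1 := t1) (γ := g) (η := h)
      (w := fun t x => A * (1 - Real.exp (-(k * (σ * (ξ t - x))))) - s * (u t x - δ)) hd
      (hsol.g_reg.continuousOn.mono hsub) (hsol.h_reg.continuousOn.mono hsub)
      ?_ ?_ ?_ ?_ ?_
    · intro x hx
      have := this t1 ⟨ht1.1, le_rfl⟩ x hx
      linarith
    · refine ContinuousOn.mono (s := {p : ℝ × ℝ | p.1 ∈ Icc 0 T ∧ p.2 ∈ Icc (g p.1) (h p.1)}) ?_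
        (fun p hp => ⟨hsub hp.1, hp.2⟩)
      have hE : ContinuousOn (fun p : ℝ × ℝ => Real.exp (-(k * (σ * (ξ p.1 - p.2)))))
          {p : ℝ × ℝ | p.1 ∈ Icc 0 T ∧ p.2 ∈ Icc (g p.1) (h p.1)} :=
        Real.continuous_exp.comp_continuousOn
          (continuousOn_const.mul (continuousOn_const.mul (hξc.sub continuousOn_snd))).neg
      exact (continuousOn_const.mul (continuousOn_const.sub hE)).sub
        (continuousOn_const.mul (hsol.u_cont.sub continuousOn_const))
    · intro x hx
      have h0 : (0:ℝ) ∈ Icc 0 T := ⟨le_rfl, hT.le⟩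
      have hs0 := hside 0 h0 x hx
      have hab := habs 0 h0 x hx
      have hr := hR' 0 h0 x hx
      rw [hsol.g_init, hsol.h_init] at hx
      rw [hsol.u_init x hx]
      have h1 := hK0 x hx (ξ 0) hξ0
      rw [hξδ, abs_sub_comm x, ← hab] at h1
      set y := σ * (ξ 0 - x) with hy
      have h2 : s * (u₀ x - δ) ≤ |u₀ x - δ| := by
        have := le_abs_self (s * (u₀ x - δ))
        rwa [abs_mul, hsa, one_mul] at this
      have h3 : k * y * q ≤ 1 - Real.exp (-(k * y)) := by
        have e1 := Real.add_one_le_exp (k * y)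
        have e2 : q ≤ Real.exp (-(k * y)) := Real.exp_le_exp.2 (by nlinarith)
        have e3 : Real.exp (k * y) * Real.exp (-(k * y)) = 1 := by
          rw [← Real.exp_add]; simp
        have e4 : 0 ≤ k * y := by positivity
        nlinarith [Real.exp_pos (-(k * y))]
      have h4 : A * (k * y * q) ≤ A * (1 - Real.exp (-(k * y))) :=
        mul_le_mul_of_nonneg_left h3 hA0
      have h5 : A * (k * y * q) = (K0 + F0) * y := by rw [← hAkq]; ring
      nlinarith
    · intro t ht hle
      exact hb t ht _ ⟨le_rfl, hle⟩ (hbc t (hsub ht)).1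
    · intro t ht hle
      exact hb t ht _ ⟨hle, le_rfl⟩ (hbc t (hsub ht)).2
    · intro t ht x hx _
      have htT := hsub ⟨ht.1.le, ht.2⟩
      have hxI : x ∈ Icc (g t) (h t) := ⟨hx.1.le, hx.2.le⟩
      obtain ⟨ut, uxx, h1, h2, h3, h4⟩ := aux_data hsol htT ht.1 hx
      obtain ⟨hξ', hξB⟩ := hB t ⟨ht.1, lt_of_le_of_lt ht.2 ht1.2⟩
      set e := Real.exp (-(k * (σ * (ξ t - x)))) with he
      refine ⟨A * (e * (k * (σ * deriv ξ t))) - s * ut, -(A * (e * (k * σ) * (k * σ))) - s * uxx,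
        fun y => -(A * (Real.exp (-(k * (σ * (ξ t - y)))) * (k * σ))) - s * deriv (u t) y,
        ?_, ?_, ?_, ?_⟩
      · have a1 := ((((hξ'.sub_const x).const_mul σ).const_mul k).neg.exp.const_sub 1).const_mul A
        convert! a1.sub ((h1.sub_const δ).const_mul s) using 1
        simp only [Pi.neg_apply, he]; ring
      · filter_upwards [h2] with y hy
        have a1 := (((((hasDerivAt_id y).const_sub (ξ t)).const_mul σ).const_mul
          k).neg.exp.const_sub 1).const_mul A
        convert! a1.sub ((hy.sub_const δ).const_mul s) using 1
        simp only [Pi.neg_apply, id]; ring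
      · have a1 := (((((((hasDerivAt_id x).const_sub (ξ t)).const_mul σ).const_mul
          k).neg.exp).mul_const (k * σ)).const_mul A).neg
        convert! a1.sub (h3.const_mul s) using 1
        simp only [Pi.neg_apply, id, he]; ring
      · have e1 : q ≤ e := Real.exp_le_exp.2 (by nlinarith [hR' t htT x hxI])
        have e2 : -B ≤ σ * deriv ξ t := by
          have := neg_abs_le (σ * deriv ξ t)
          rw [abs_mul, hσa, one_mul] at this
          linarith
        have e3 : s * f t x (u t x) ≤ F0 := by
          have := le_abs_self (s * f t x (u t x))
          rw [abs_mul, hsa, one_mul] at this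
          exact this.trans (hF t htT x hxI)
        have e4 : K0 + F0 ≤ A * k * e * (σ * deriv ξ t + d * k) := by
          have : A * k * q ≤ A * k * e := mul_le_mul_of_nonneg_left e1 (by positivity)
          have h1 : 1 ≤ σ * deriv ξ t + d * k := by rw [hdk]; linarith
          have h2 : 0 ≤ A * k * e := by positivity
          nlinarith
        have e5 : d * (-(A * (e * (k * σ) * (k * σ))) - s * uxx) =
            - (A * k * e * (d * k)) * (σ * σ) - s * (d * uxx) := by ring
        rw [e5, hσ2, h4]
        nlinarith
  intro t ht x hx
  have htT : t ∈ Icc 0 T := ⟨ht.1, ht.2.le⟩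
  have h1 := key 1 (Or.inl rfl) t ht x hx
  have h2 := key (-1) (Or.inr rfl) t ht x hx
  rw [habs t htT x hx] at h1 h2
  have h3 : 1 - Real.exp (-(k * |ξ t - x|)) ≤ k * |ξ t - x| := by
    linarith [Real.add_one_le_exp (-(k * |ξ t - x|))]
  have h4 : A * (1 - Real.exp (-(k * |ξ t - x|))) ≤ A * (k * |ξ t - x|) :=
    mul_le_mul_of_nonneg_left h3 hA0
  rw [abs_le]
  constructor <;> linarith

end bdry

/-- extension of a solution to the whole plane by clamping -/
noncomputable def auxClamp (T t : ℝ) : ℝ := max 0 (min t T)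

noncomputable def auxExt (T : ℝ) (u : ℝ → ℝ → ℝ) (g h : ℝ → ℝ) (t x : ℝ) : ℝ :=
  u (auxClamp T t) (max (g (auxClamp T t)) (min x (h (auxClamp T t))))

lemma auxClamp_mem {T : ℝ} (hT : 0 < T) (t : ℝ) : auxClamp T t ∈ Icc 0 T :=
  ⟨le_max_left _ _, max_le hT.le (min_le_right _ _)⟩

lemma auxClamp_eq {T t : ℝ} (ht : t ∈ Icc 0 T) : auxClamp T t = t := by
  unfold auxClamp; rw [min_eq_left ht.2, max_eq_right ht.1]

lemma auxClamp_cont (T : ℝ) : Continuous (auxClamp T) := by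
  unfold auxClamp; fun_prop

section ext
variable {d δ h₀ T : ℝ} {f : ℝ → ℝ → ℝ → ℝ} {u₀ : ℝ → ℝ} {u : ℝ → ℝ → ℝ} {g h : ℝ → ℝ}

lemma aux_clampx_mem (hT : 0 < T) (hsol : ClassicalSolution d δ h₀ f u₀ (Icc 0 T) u g h) (t x : ℝ) :
    max (g (auxClamp T t)) (min x (h (auxClamp T t))) ∈
      Icc (g (auxClamp T t)) (h (auxClamp T t)) :=
  ⟨le_max_left _ _, max_le (hsol.g_lt_h _ (auxClamp_mem hT t)).le (min_le_right _ _)⟩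

lemma auxExt_cont (hT : 0 < T) (hsol : ClassicalSolution d δ h₀ f u₀ (Icc 0 T) u g h) :
    Continuous (fun p : ℝ × ℝ => auxExt T u g h p.1 p.2) := by
  have hg : Continuous fun t => g (auxClamp T t) :=
    hsol.g_reg.continuousOn.comp_continuous (auxClamp_cont T) (auxClamp_mem hT)
  have hh : Continuous fun t => h (auxClamp T t) :=
    hsol.h_reg.continuousOn.comp_continuous (auxClamp_cont T) (auxClamp_mem hT)
  have hc := auxClamp_cont T
  have hm : Continuous fun p : ℝ × ℝ => ((auxClamp T p.1,
      max (g (auxClamp T p.1)) (min p.2 (h (auxClamp T p.1)))) : ℝ × ℝ) := by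
    refine (hc.comp continuous_fst).prodMk ((hg.comp continuous_fst).max
      (continuous_snd.min (hh.comp continuous_fst)))
  exact hsol.u_cont.comp_continuous hm
    (fun p => ⟨auxClamp_mem hT p.1, aux_clampx_mem hT hsol p.1 p.2⟩)

lemma auxExt_eq {t x : ℝ} (ht : t ∈ Icc 0 T) (hx : x ∈ Icc (g t) (h t)) :
    auxExt T u g h t x = u t x := by
  unfold auxExt
  rw [auxClamp_eq ht, min_eq_left hx.2, max_eq_right hx.1]

lemma auxExt_left (hsol : ClassicalSolution d δ h₀ f u₀ (Icc 0 T) u g h)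
    (hu₀ : InX δ h₀ u₀) (hh₀ : 0 < h₀) {t x : ℝ} (ht : t ∈ Icc 0 T)
    (hx : x ≤ g t) : auxExt T u g h t x = δ := by
  unfold auxExt
  rw [auxClamp_eq ht, max_eq_left ((min_le_left _ _).trans hx)]
  exact (aux_bc hu₀ hh₀ hsol t ht).1

lemma auxExt_right (hsol : ClassicalSolution d δ h₀ f u₀ (Icc 0 T) u g h)
    (hu₀ : InX δ h₀ u₀) (hh₀ : 0 < h₀) {t x : ℝ} (ht : t ∈ Icc 0 T)
    (hx : h t ≤ x) : auxExt T u g h t x = δ := by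
  unfold auxExt
  rw [auxClamp_eq ht, min_eq_right hx, max_eq_right (hsol.g_lt_h t ht).le]
  exact (aux_bc hu₀ hh₀ hsol t ht).2

lemma auxF_cont {β M : ℝ} {v : ℝ → ℝ → ℝ} (hf2 : CondF2 f β) (hT : 0 < T) (hM : 0 < M)
    (hv : Continuous (fun p : ℝ × ℝ => v p.1 p.2)) (hvM : ∀ t x, v t x ∈ Icc 0 M) :
    Continuous (fun p : ℝ × ℝ => f (auxClamp T p.1) p.2 (v p.1 p.2)) := by
  obtain ⟨⟨hβ0, hβ1⟩, hH, -, -, hLip⟩ := hf2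
  obtain ⟨C, hC, hC'⟩ := hH M hM
  obtain ⟨L, hL, hL'⟩ := hLip M hM
  rw [continuous_iff_continuousAt]
  intro p
  rw [ContinuousAt, tendsto_iff_norm_sub_tendsto_zero]
  have hc := auxClamp_cont T
  have hlim : Tendsto (fun q : ℝ × ℝ =>
      C * (|auxClamp T q.1 - auxClamp T p.1| ^ (β / 2) + |q.2 - p.2| ^ β)
        + L * |v q.1 q.2 - v p.1 p.2|) (nhds p) (nhds 0) := by
    have hcont : Continuous (fun q : ℝ × ℝ =>
      C * (|auxClamp T q.1 - auxClamp T p.1| ^ (β / 2) + |q.2 - p.2| ^ β)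
        + L * |v q.1 q.2 - v p.1 p.2|) := by
      refine (continuous_const.mul (Continuous.add ?_ ?_)).add (continuous_const.mul
        (hv.sub continuous_const).abs)
      · exact (((hc.comp continuous_fst).sub continuous_const).abs).rpow_const
          (fun _ => Or.inr (by positivity))
      · exact ((continuous_snd.sub continuous_const).abs).rpow_const
          (fun _ => Or.inr hβ0.le)
    have h0 := hcont.tendsto p
    simpa [Real.zero_rpow (by positivity : β / 2 ≠ 0), Real.zero_rpow hβ0.ne'] using h0
  refine squeeze_zero (fun _ => norm_nonneg _) (fun q => ?_) hlim
  have h1 := hC' (auxClamp T q.1) (auxClamp_mem hT _).1 (auxClamp T p.1) (auxClamp_mem hT _).1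
    q.2 p.2 (v q.1 q.2) (hvM _ _)
  have h2 := hL' (auxClamp T p.1) (auxClamp_mem hT _).1 p.2 (v q.1 q.2) (hvM _ _)
    (v p.1 p.2) (hvM _ _)
  rw [Real.norm_eq_abs]
  calc _ = |(f (auxClamp T q.1) q.2 (v q.1 q.2) - f (auxClamp T p.1) p.2 (v q.1 q.2))
        + (f (auxClamp T p.1) p.2 (v q.1 q.2) - f (auxClamp T p.1) p.2 (v p.1 p.2))| := by
        congr 1; ring
    _ ≤ _ := (abs_add_le _ _).trans (add_le_add h1 h2)

end ext

lemma aux_tlu {Φ : ℝ → ℝ → ℝ} {S : Set ℝ}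
    (hc : ContinuousOn (fun p : ℝ × ℝ => Φ p.1 p.2) (S ×ˢ Ico 0 1)) :
    TendstoLocallyUniformlyOn (fun n y => Φ y n) (fun y => Φ y 0) (nhdsWithin 0 (Ioi 0)) S := by
  rw [Metric.tendstoLocallyUniformlyOn_iff]
  intro ε hε x hx
  have h0 : (0:ℝ) ∈ Ico (0:ℝ) 1 := ⟨le_rfl, one_pos⟩
  have h1 := (hc (x, 0) ⟨hx, h0⟩).eventually (Metric.ball_mem_nhds _ (half_pos hε))
  rw [nhdsWithin_prod_eq] at h1
  obtain ⟨pa, hpa, pb, hpb, hab⟩ := eventually_prod_iff.1 h1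
  refine ⟨{y | pa y}, hpa, ?_⟩
  have hle : nhdsWithin (0:ℝ) (Ioi 0) ≤ nhdsWithin 0 (Ico 0 1) := by
    rw [← nhdsWithin_Ioo_eq_nhdsGT (one_pos : (0:ℝ) < 1)]
    exact nhdsWithin_mono _ Ioo_subset_Ico_self
  filter_upwards [hle hpb] with n hn y hy
  have e1 := hab hy hn
  have e2 := hab hy (hpb.self_of_nhdsWithin h0)
  simp only [Metric.mem_ball] at e1 e2
  calc _ ≤ dist (Φ y 0) (Φ x 0) + dist (Φ y n) (Φ x 0) := dist_triangle_right _ _ _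
    _ < ε := by linarith

section mass
variable {d δ h₀ T : ℝ} {f : ℝ → ℝ → ℝ → ℝ} {u₀ : ℝ → ℝ} {u : ℝ → ℝ → ℝ} {g h : ℝ → ℝ}

lemma aux_tube (hsol : ClassicalSolution d δ h₀ f u₀ (Icc 0 T) u g h) {t a b : ℝ}
    (ht : t ∈ Ioo 0 T) (ha : g t < a) (hb : b < h t) :
    ∀ᶠ s in nhds t, s ∈ Ioo 0 T ∧ g s < a ∧ b < h s := by
  have hn : Icc 0 T ∈ nhds t := Icc_mem_nhds ht.1 ht.2
  have hg := (hsol.g_reg.continuousOn.continuousAt hn).eventually_lt continuousAt_const ha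
  have hh := continuousAt_const.eventually_lt (hsol.h_reg.continuousOn.continuousAt hn) hb
  filter_upwards [Ioo_mem_nhds ht.1 ht.2, hg, hh] with s h1 h2 h3 using ⟨h1, h2, h3⟩

lemma aux_uIcc {A B a x y : ℝ} (ha : a ∈ Ioo A B) (hx : x ∈ Ioo A B) (hy : y ∈ uIcc a x) :
    y ∈ Ioo A B :=
  ⟨(lt_min ha.1 hx.1).trans_le hy.1, hy.2.trans_lt (max_lt ha.2 hx.2)⟩

noncomputable def auxQ (d T : ℝ) (u : ℝ → ℝ → ℝ) (g h : ℝ → ℝ) (Fh : ℝ → ℝ → ℝ) (a t x : ℝ) : ℝ :=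
  d * (deriv (u t) x * (x - a) - auxExt T u g h t x + auxExt T u g h t a)
    + ∫ y in a..x, Fh t y * (y - a)

lemma aux_time_deriv (hT : 0 < T) (hsol : ClassicalSolution d δ h₀ f u₀ (Icc 0 T) u g h)
    {Fh : ℝ → ℝ → ℝ} (hFc : Continuous (fun p : ℝ × ℝ => Fh p.1 p.2))
    (hFe : ∀ t ∈ Icc 0 T, ∀ x ∈ Icc (g t) (h t), Fh t x = f t x (u t x))
    {t a x : ℝ} (ht : t ∈ Ioo 0 T) (ha : a ∈ Ioo (g t) (h t)) (hx : x ∈ Ioo (g t) (h t)) :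
    HasDerivAt (fun s => ∫ y in a..x, auxExt T u g h s y * (y - a))
      (auxQ d T u g h Fh a t x) t := by
  have htI : t ∈ Icc 0 T := ⟨ht.1.le, ht.2.le⟩
  have hUc := auxExt_cont hT hsol
  have hev := aux_tube hsol ht (lt_min ha.1 hx.1) (max_lt ha.2 hx.2)
  obtain ⟨ε, hε, hball⟩ := Metric.eventually_nhds_iff_ball.1 hev
  have hin : ∀ s ∈ Metric.ball t ε, ∀ y ∈ uIcc a x, s ∈ Ioo 0 T ∧ y ∈ Ioo (g s) (h s) := by
    intro s hs y hy
    obtain ⟨h1, h2, h3⟩ := hball s hs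
    exact ⟨h1, h2.trans_le hy.1, hy.2.trans_lt h3⟩
  have hsub : Metric.closedBall t (ε/2) ⊆ Metric.ball t ε :=
    Metric.closedBall_subset_ball (by linarith)
  have hcomp : IsCompact (Metric.closedBall t (ε/2) ×ˢ uIcc a x) :=
    (isCompact_closedBall t (ε/2)).prod isCompact_uIcc
  have hutc : ContinuousOn (fun p : ℝ × ℝ => deriv (fun s => u s p.2) p.1 * (p.2 - a))
      (Metric.closedBall t (ε/2) ×ˢ uIcc a x) := by
    refine (hsol.ut_cont.mono ?_).mul (by fun_prop)
    rintro ⟨s, y⟩ ⟨hs, hy⟩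
    obtain ⟨h1, h2⟩ := hin s (hsub hs) y hy
    exact ⟨⟨h1.1.le, h1.2.le⟩, h1.1, h2⟩
  obtain ⟨C, hC⟩ := hcomp.exists_bound_of_continuousOn hutc
  have hslice : ContinuousOn (fun y => deriv (fun s => u s y) t * (y - a)) (uIcc a x) := by
    have : ContinuousOn (fun y : ℝ => (t, y)) (uIcc a x) := by fun_prop
    exact hutc.comp this (fun y hy => ⟨Metric.mem_closedBall_self (by linarith), hy⟩)
  have key := intervalIntegral.hasDerivAt_integral_of_dominated_loc_of_deriv_le
    (μ := MeasureTheory.volume) (a := a) (b := x)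
    (F := fun s y => auxExt T u g h s y * (y - a))
    (F' := fun s y => deriv (fun s => u s y) s * (y - a)) (x₀ := t)
    (s := Metric.closedBall t (ε/2)) (bound := fun _ => C)
    (Metric.closedBall_mem_nhds t (by linarith))
    (Eventually.of_forall fun s => by
      have : Continuous (fun y => auxExt T u g h s y * (y - a)) :=
        (hUc.comp (by fun_prop : Continuous fun y : ℝ => (s, y))).mul (by fun_prop)
      exact this.aestronglyMeasurable)
    (by
      have : Continuous (fun y => auxExt T u g h t y * (y - a)) :=
        (hUc.comp (by fun_prop : Continuous fun y : ℝ => (t, y))).mul (by fun_prop)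
      exact this.intervalIntegrable _ _)
    ((hslice.mono uIoc_subset_uIcc).aestronglyMeasurable measurableSet_uIoc)
    (Eventually.of_forall fun y hy s hs => hC (s, y) ⟨hs, uIoc_subset_uIcc hy⟩)
    (by simp)
    (Eventually.of_forall fun y hy s hs => by
      obtain ⟨h1, h2⟩ := hin s (hsub hs) y (uIoc_subset_uIcc hy)
      have hd1 := (hsol.ut_diff s ⟨h1.1.le, h1.2.le⟩ h1.1 y h2).hasDerivAt
      have he : (fun s => auxExt T u g h s y) =ᶠ[nhds s] fun s => u s y := by
        filter_upwards [Metric.isOpen_ball.mem_nhds (hsub hs)] with r hr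
        obtain ⟨h3, h4⟩ := hin r hr y (uIoc_subset_uIcc hy)
        exact auxExt_eq ⟨h3.1.le, h3.2.le⟩ ⟨h4.1.le, h4.2.le⟩
      exact (hd1.congr_of_eventuallyEq he).mul_const _)
  refine key.2.congr_deriv ?_
  have hI : ∀ y ∈ uIcc a x, y ∈ Ioo (g t) (h t) := fun y hy => aux_uIcc ha hx hy
  have hxxc : ContinuousOn (fun y => d * deriv (deriv (u t)) y * (y - a)) (uIcc a x) := by
    have : ContinuousOn (fun y : ℝ => (t, y)) (uIcc a x) := by fun_prop
    have h2 := hsol.uxx_cont.comp this (fun y hy => ⟨htI, ht.1, hI y hy⟩)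
    exact (continuousOn_const.mul h2).mul (by fun_prop)
  have hFs : Continuous (fun y => Fh t y * (y - a)) :=
    (hFc.comp (by fun_prop : Continuous fun y : ℝ => (t, y))).mul (by fun_prop)
  have e1 : ∫ y in a..x, deriv (fun s => u s y) t * (y - a)
      = ∫ y in a..x, (d * deriv (deriv (u t)) y * (y - a) + Fh t y * (y - a)) := by
    apply intervalIntegral.integral_congr
    intro y hy
    have hy' := hI y hy
    simp only
    rw [hsol.pde t htI ht.1 y hy', hFe t htI y ⟨hy'.1.le, hy'.2.le⟩]
    ring
  have e2 : ∫ y in a..x, d * deriv (deriv (u t)) y * (y - a)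
      = d * (deriv (u t) x * (x - a) - u t x) - d * (deriv (u t) a * (a - a) - u t a) := by
    refine intervalIntegral.integral_eq_sub_of_hasDerivAt
      (f := fun y => d * (deriv (u t) y * (y - a) - u t y)) (fun y hy => ?_)
      hxxc.intervalIntegrable
    have hy' := hI y hy
    have h1 := (hsol.uxx_diff t htI ht.1 y hy').hasDerivAt
    have h2 := (hsol.ux_diff t htI ht.1 y ⟨hy'.1.le, hy'.2.le⟩).hasDerivAt
    refine (((h1.mul ((hasDerivAt_id y).sub_const a)).sub h2).const_mul d).congr_deriv ?_
    simp only [id]; ring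
  rw [e1, intervalIntegral.integral_add hxxc.intervalIntegrable (hFs.intervalIntegrable _ _), e2]
  unfold auxQ
  rw [auxExt_eq htI ⟨hx.1.le, hx.2.le⟩, auxExt_eq htI ⟨ha.1.le, ha.2.le⟩]
  ring

/-- continuity of `auxQ` up to the boundary -/
lemma auxQ_cont (hT : 0 < T) (hsol : ClassicalSolution d δ h₀ f u₀ (Icc 0 T) u g h)
    {Fh : ℝ → ℝ → ℝ} (hFc : Continuous (fun p : ℝ × ℝ => Fh p.1 p.2)) (a : ℝ) :
    ContinuousOn (fun p : ℝ × ℝ => auxQ d T u g h Fh a p.1 p.2)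
      {p : ℝ × ℝ | p.1 ∈ Icc 0 T ∧ 0 < p.1 ∧ p.2 ∈ Icc (g p.1) (h p.1)} := by
  have hUc := auxExt_cont hT hsol
  unfold auxQ
  have h1 : Continuous (fun p : ℝ × ℝ => ∫ y in a..p.2, Fh p.1 y * (y - a)) := by
    apply intervalIntegral.continuous_parametric_intervalIntegral_of_continuous
      (f := fun (p : ℝ × ℝ) y => Fh p.1 y * (y - a)) (s := fun p : ℝ × ℝ => p.2)
    · exact (hFc.comp (by fun_prop : Continuous fun q : (ℝ × ℝ) × ℝ => (q.1.1, q.2))).mul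
        (by fun_prop)
    · fun_prop
  have h2 : Continuous (fun p : ℝ × ℝ => auxExt T u g h p.1 a) :=
    hUc.comp (by fun_prop : Continuous fun q : ℝ × ℝ => (q.1, a))
  exact (continuousOn_const.mul (((hsol.ux_cont.mul (by fun_prop)).sub hUc.continuousOn).add
    h2.continuousOn)).add h1.continuousOn

lemma aux_curve_deriv (hT : 0 < T) (hsol : ClassicalSolution d δ h₀ f u₀ (Icc 0 T) u g h)
    {Fh : ℝ → ℝ → ℝ} (hFc : Continuous (fun p : ℝ × ℝ => Fh p.1 p.2))
    (hFe : ∀ t ∈ Icc 0 T, ∀ x ∈ Icc (g t) (h t), Fh t x = f t x (u t x))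
    {t a b' : ℝ} {b : ℝ → ℝ} (ht : t ∈ Ioo 0 T) (ha : a ∈ Ioo (g t) (h t))
    (hb : b t ∈ Ioo (g t) (h t)) (hb' : HasDerivAt b b' t) :
    HasDerivAt (fun s => ∫ y in a..b s, auxExt T u g h s y * (y - a))
      (auxQ d T u g h Fh a t (b t) + auxExt T u g h t (b t) * (b t - a) * b') t := by
  have hUc := auxExt_cont hT hsol
  have hev : ∀ᶠ p in nhds (t, b t), p.1 ∈ Ioo 0 T ∧ a ∈ Ioo (g p.1) (h p.1) ∧
      p.2 ∈ Ioo (g p.1) (h p.1) := by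
    obtain ⟨c1, hc1, hc1'⟩ := exists_between hb.1
    obtain ⟨c2, hc2, hc2'⟩ := exists_between hb.2
    have h1 := aux_tube hsol ht ha.1 ha.2
    have h2 := aux_tube hsol ht hc1 hc2'
    have h3 : ∀ᶠ y in nhds (b t), y ∈ Ioo c1 c2 := Ioo_mem_nhds hc1' hc2
    rw [nhds_prod_eq]
    filter_upwards [(h1.and h2).prod_mk h3] with p hp
    obtain ⟨⟨⟨q1, q2, q3⟩, ⟨-, q4, q5⟩⟩, q6⟩ := hp
    exact ⟨q1, ⟨q2, q3⟩, ⟨q4.trans q6.1, q6.2.trans q5⟩⟩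
  have hstrict := hasStrictFDerivAt_uncurry_coprod (𝕜 := ℝ) (u := (t, b t))
    (f := fun s x => ∫ y in a..x, auxExt T u g h s y * (y - a))
    (f₁ := fun s x => ContinuousLinearMap.toSpanSingleton ℝ (auxQ d T u g h Fh a s x))
    (f₂ := fun s x => ContinuousLinearMap.toSpanSingleton ℝ (auxExt T u g h s x * (x - a)))
    (by
      filter_upwards [hev] with p hp
      exact (aux_time_deriv hT hsol hFc hFe hp.1 hp.2.1 hp.2.2).hasFDerivAt)
    (by
      filter_upwards [hev] with p hp
      have hc : Continuous (fun y => auxExt T u g h p.1 y * (y - a)) :=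
        (hUc.comp (by fun_prop : Continuous fun y : ℝ => (p.1, y))).mul (by fun_prop)
      exact (hc.integral_hasStrictDerivAt a p.2).hasDerivAt.hasFDerivAt)
    (by
      have h1 : ContinuousAt (fun p : ℝ × ℝ => auxQ d T u g h Fh a p.1 p.2) (t, b t) := by
        refine (auxQ_cont hT hsol hFc a).continuousAt ?_
        filter_upwards [hev] with p hp
        exact ⟨⟨hp.1.1.le, hp.1.2.le⟩, hp.1.1, ⟨hp.2.2.1.le, hp.2.2.2.le⟩⟩
      exact (ContinuousLinearMap.toSpanSingletonCLE (𝕜 := ℝ) (E := ℝ)).continuous.continuousAt.comp h1)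
    (by
      have h1 : Continuous (fun p : ℝ × ℝ => auxExt T u g h p.1 p.2 * (p.2 - a)) :=
        hUc.mul (by fun_prop)
      exact ((ContinuousLinearMap.toSpanSingletonCLE (𝕜 := ℝ) (E := ℝ)).continuous.comp h1).continuousAt)
  have hcurve : HasDerivAt (fun s => (s, b s)) ((1:ℝ), b') t := (hasDerivAt_id t).prodMk hb'
  have := hstrict.hasFDerivAt.comp_hasDerivAt t hcurve
  refine this.congr_deriv ?_
  simp [Function.HasUncurry.uncurry]
  ring

end mass

section mass2
variable {d δ h₀ T : ℝ} {f : ℝ → ℝ → ℝ → ℝ} {u₀ : ℝ → ℝ} {u : ℝ → ℝ → ℝ} {g h : ℝ → ℝ}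

lemma aux_mass_deriv (hδ : 0 < δ) (hT : 0 < T) (hh₀ : 0 < h₀) (hu₀ : InX δ h₀ u₀)
    (hsol : ClassicalSolution d δ h₀ f u₀ (Icc 0 T) u g h)
    {Fh : ℝ → ℝ → ℝ} (hFc : Continuous (fun p : ℝ × ℝ => Fh p.1 p.2))
    (hFe : ∀ t ∈ Icc 0 T, ∀ x ∈ Icc (g t) (h t), Fh t x = f t x (u t x))
    {s0 s1 a : ℝ} {ξ : ℝ → ℝ} (hξ : ξ = g ∨ ξ = h) (h0 : 0 ≤ s0) (h1 : s1 ≤ T)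
    (ha : ∀ t ∈ Ioo s0 s1, a ∈ Ioo (g t) (h t)) :
    ∀ t ∈ Ioo s0 s1, HasDerivAt (fun s => ∫ y in a..ξ s, auxExt T u g h s y * (y - a))
      (d * (auxExt T u g h t a - δ) + ∫ y in a..ξ t, Fh t y * (y - a)) t := by
  intro t ht
  have hUc := auxExt_cont hT hsol
  have hS : ∀ s ∈ Ioo s0 s1, s ∈ Ioo 0 T := fun s hs => ⟨h0.trans_lt hs.1, hs.2.trans_le h1⟩
  have hξreg : ContDiffOn ℝ 1 ξ (Icc 0 T) := by
    rcases hξ with rfl | rfl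
    exacts [hsol.g_reg, hsol.h_reg]
  have hξst : ∀ s ∈ Ioo 0 T, deriv ξ s = -(d / δ) * deriv (u s) (ξ s) := by
    intro s hs
    rcases hξ with rfl | rfl
    exacts [hsol.stefan_g s ⟨hs.1.le, hs.2.le⟩ hs.1, hsol.stefan_h s ⟨hs.1.le, hs.2.le⟩ hs.1]
  have hξm : ∀ s ∈ Ioo 0 T, ξ s ∈ Icc (g s) (h s) := by
    intro s hs
    have := hsol.g_lt_h s ⟨hs.1.le, hs.2.le⟩
    rcases hξ with rfl | rfl
    exacts [⟨le_rfl, this.le⟩, ⟨this.le, le_rfl⟩]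
  have hξδ : ∀ s ∈ Ioo 0 T, u s (ξ s) = δ := by
    intro s hs
    have := aux_bc hu₀ hh₀ hsol s ⟨hs.1.le, hs.2.le⟩
    rcases hξ with rfl | rfl
    exacts [this.1, this.2]
  obtain ⟨B, -, hB⟩ := aux_deriv_bound hT hξreg
  have hbI : ∀ s ∈ Ioo s0 s1, ∀ e ∈ Ico (0:ℝ) 1, a + (1 - e) * (ξ s - a) ∈ Icc (g s) (h s) := by
    intro s hs e he
    have q1 := ha s hs
    have q2 := hξm s (hS s hs)
    constructor <;> nlinarith [q1.1, q1.2, q2.1, q2.2, he.1, he.2]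
  have hbO : ∀ s ∈ Ioo s0 s1, ∀ e ∈ Ioo (0:ℝ) 1, a + (1 - e) * (ξ s - a) ∈ Ioo (g s) (h s) := by
    intro s hs e he
    have q1 := ha s hs
    have q2 := hξm s (hS s hs)
    constructor <;> nlinarith [q1.1, q1.2, q2.1, q2.2, he.1, he.2]
  set Φ : ℝ → ℝ → ℝ := fun s e => auxQ d T u g h Fh a s (a + (1 - e) * (ξ s - a))
    + auxExt T u g h s (a + (1 - e) * (ξ s - a)) * (a + (1 - e) * (ξ s - a) - a)
      * ((1 - e) * deriv ξ s) with hΦ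
  have hξc : ContinuousOn ξ (Ioo s0 s1) := hξreg.continuousOn.mono
    (fun s hs => ⟨(hS s hs).1.le, (hS s hs).2.le⟩)
  have hξ'c : ContinuousOn (deriv ξ) (Ioo s0 s1) := by
    have q : ContinuousOn (fun s => -(d / δ) * deriv (u s) (ξ s)) (Ioo s0 s1) := by
      refine continuousOn_const.mul ?_
      exact hsol.ux_cont.comp (continuousOn_id.prodMk hξc)
        (fun s hs => ⟨⟨(hS s hs).1.le, (hS s hs).2.le⟩, (hS s hs).1, hξm s (hS s hs)⟩)
    exact q.congr (fun s hs => hξst s (hS s hs))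
  have hΦc : ContinuousOn (fun p : ℝ × ℝ => Φ p.1 p.2) (Ioo s0 s1 ×ˢ Ico 0 1) := by
    have c1 : ContinuousOn (fun p : ℝ × ℝ => ξ p.1) (Ioo s0 s1 ×ˢ Ico (0:ℝ) 1) :=
      hξc.comp continuousOn_fst (fun p hp => hp.1)
    have c2 : ContinuousOn (fun p : ℝ × ℝ => deriv ξ p.1) (Ioo s0 s1 ×ˢ Ico (0:ℝ) 1) :=
      hξ'c.comp continuousOn_fst (fun p hp => hp.1)
    have c3 : ContinuousOn (fun p : ℝ × ℝ => (p.1, a + (1 - p.2) * (ξ p.1 - a)))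
        (Ioo s0 s1 ×ˢ Ico (0:ℝ) 1) := continuousOn_fst.prodMk
      (continuousOn_const.add ((continuousOn_const.sub continuousOn_snd).mul
        (c1.sub continuousOn_const)))
    have c4 := (auxQ_cont hT hsol hFc a).comp c3 (fun p hp =>
      ⟨⟨(hS _ hp.1).1.le, (hS _ hp.1).2.le⟩, (hS _ hp.1).1, hbI _ hp.1 _ hp.2⟩)
    have c5 := hUc.comp_continuousOn c3
    exact c4.add ((c5.mul (c3.snd.sub continuousOn_const)).mul
      ((continuousOn_const.sub continuousOn_snd).mul c2))
  have hder := hasDerivAt_of_tendstoLocallyUniformlyOn (isOpen_Ioo (a := s0) (b := s1))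
    (aux_tlu hΦc) (f := fun e s => ∫ y in a..(a + (1 - e) * (ξ s - a)), auxExt T u g h s y * (y - a))
    (g := fun s => ∫ y in a..ξ s, auxExt T u g h s y * (y - a)) (x := t)
    (by
      filter_upwards [Ioo_mem_nhdsGT (one_pos : (0:ℝ) < 1)] with e he s hs
      exact aux_curve_deriv (b := fun s => a + (1 - e) * (ξ s - a)) hT hsol hFc hFe (hS s hs)
        (ha s hs) (hbO s hs e he) ((((hB s (hS s hs)).1.sub_const a).const_mul (1 - e)).const_add a))
    (by
      intro s hs
      have hc : Continuous (fun y => auxExt T u g h s y * (y - a)) :=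
        (hUc.comp (by fun_prop : Continuous fun y : ℝ => (s, y))).mul (by fun_prop)
      have hc2 : Continuous (fun e => ∫ y in a..(a + (1 - e) * (ξ s - a)),
          auxExt T u g h s y * (y - a)) :=
        (intervalIntegral.continuous_primitive (fun _ _ => hc.intervalIntegrable _ _) a).comp
          (by fun_prop : Continuous fun e : ℝ => a + (1 - e) * (ξ s - a))
      have := (hc2.tendsto 0).mono_left (nhdsWithin_le_nhds (s := Ioi 0))
      simpa using this)
    ht
  refine hder.congr_deriv ?_
  have hs := hS t ht
  have e1 : auxExt T u g h t (ξ t) = δ := by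
    rw [auxExt_eq ⟨hs.1.le, hs.2.le⟩ (hξm t hs), hξδ t hs]
  simp only [hΦ, sub_zero, one_mul, add_sub_cancel, auxQ, e1, hξst t hs]
  field_simp
  ring

end mass2

/-- the properties of an extended solution used in the uniqueness argument -/
structure AuxP (d δ T K M : ℝ) (f : ℝ → ℝ → ℝ → ℝ) (U : ℝ → ℝ → ℝ) (g h : ℝ → ℝ) : Prop where
  Uc : Continuous (fun p : ℝ × ℝ => U p.1 p.2)
  gc : ContinuousOn g (Icc 0 T)
  hc : ContinuousOn h (Icc 0 T)
  glt : ∀ t ∈ Icc 0 T, g t < h t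
  rng : ∀ t x, U t x ∈ Icc 0 M
  data : ∀ t ∈ Ioo 0 T, ∀ x ∈ Ioo (g t) (h t), ∃ (ut uxx : ℝ) (ux : ℝ → ℝ),
    HasDerivAt (fun s => U s x) ut t ∧ (∀ᶠ y in nhds x, HasDerivAt (U t) (ux y) y) ∧
      HasDerivAt ux uxx x ∧ ut = d * uxx + f t x (U t x)
  lipg : ∀ t ∈ Ico 0 T, ∀ x, |U t x - δ| ≤ K * max (x - g t) 0
  liph : ∀ t ∈ Ico 0 T, ∀ x, |U t x - δ| ≤ K * max (h t - x) 0
  Fc : Continuous (fun p : ℝ × ℝ => f (auxClamp T p.1) p.2 (U p.1 p.2))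
  mass : ∀ s0 s1 a : ℝ, ∀ ξ : ℝ → ℝ, (ξ = g ∨ ξ = h) → 0 ≤ s0 → s1 ≤ T →
    (∀ t ∈ Ioo s0 s1, a ∈ Ioo (g t) (h t)) →
    ∀ t ∈ Ioo s0 s1, HasDerivAt (fun s => ∫ y in a..ξ s, U s y * (y - a))
      (d * (U t a - δ) + ∫ y in a..ξ t, f (auxClamp T t) y (U t y) * (y - a)) t

section build
variable {d δ h₀ T : ℝ} {f : ℝ → ℝ → ℝ → ℝ} {u₀ : ℝ → ℝ} {u : ℝ → ℝ → ℝ} {g h : ℝ → ℝ}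

lemma aux_dataU (hsol : ClassicalSolution d δ h₀ f u₀ (Icc 0 T) u g h) :
    ∀ t ∈ Ioo 0 T, ∀ x ∈ Ioo (g t) (h t), ∃ (ut uxx : ℝ) (ux : ℝ → ℝ),
    HasDerivAt (fun s => auxExt T u g h s x) ut t ∧
      (∀ᶠ y in nhds x, HasDerivAt (auxExt T u g h t) (ux y) y) ∧
      HasDerivAt ux uxx x ∧ ut = d * uxx + f t x (auxExt T u g h t x) := by
  intro t ht x hx
  have htI : t ∈ Icc 0 T := ⟨ht.1.le, ht.2.le⟩
  obtain ⟨ut, uxx, q1, q2, q3, q4⟩ := aux_data hsol htI ht.1 hx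
  refine ⟨ut, uxx, deriv (u t), ?_, ?_, q3, ?_⟩
  · refine q1.congr_of_eventuallyEq ?_
    filter_upwards [aux_tube hsol ht hx.1 hx.2] with s hs
    exact auxExt_eq ⟨hs.1.1.le, hs.1.2.le⟩ ⟨hs.2.1.le, hs.2.2.le⟩
  · have hev : ∀ᶠ y in nhds x, y ∈ Ioo (g t) (h t) := Ioo_mem_nhds hx.1 hx.2
    filter_upwards [q2, hev.eventually_nhds] with y hy hy2
    refine hy.congr_of_eventuallyEq ?_
    filter_upwards [hy2] with z hz
    exact auxExt_eq htI ⟨hz.1.le, hz.2.le⟩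
  · rw [auxExt_eq htI ⟨hx.1.le, hx.2.le⟩]; exact q4

lemma auxP_of_sol {β : ℝ} (hd : 0 < d) (hδ : 0 < δ) (hh₀ : 0 < h₀) (hT : 0 < T)
    (hf2 : CondF2 f β) (hu₀ : InX δ h₀ u₀)
    (hsol : ClassicalSolution d δ h₀ f u₀ (Icc 0 T) u g h) :
    ∃ M0 > 0, ∃ K0 ≥ 0, ∀ M ≥ M0, ∀ K ≥ K0, AuxP d δ T K M f (auxExt T u g h) g h := by
  obtain ⟨M0, hM0, hbd⟩ := aux_bound hsol
  have hpos := aux_pos hd hδ hh₀ hf2 hu₀ hsol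
  obtain ⟨L, hL, hLip⟩ := hf2.2.2.2.2 M0 hM0
  have hF : ∀ t ∈ Icc 0 T, ∀ x ∈ Icc (g t) (h t), |f t x (u t x)| ≤ L * M0 := by
    intro t ht x hx
    have q1 := hbd t ht x hx
    have q2 := hpos t ht x hx
    have q3 := hLip t ht.1 x (u t x) ⟨q2, (le_abs_self _).trans q1⟩ 0 ⟨le_rfl, hM0.le⟩
    rw [hf2.2.2.2.1 t ht.1 x, sub_zero, sub_zero] at q3
    exact q3.trans (mul_le_mul_of_nonneg_left q1 hL.le)
  obtain ⟨K1, hK1, hK1'⟩ := aux_barrier hd hh₀ hT hu₀ hsol hF (ξ := g) (σ := -1) (Or.inr rfl)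
    hsol.g_reg (by rw [hsol.g_init]; constructor <;> linarith) (by rw [hsol.g_init]; exact hu₀.2.1)
    (fun t ht x hx => by linarith [hx.1])
  obtain ⟨K2, hK2, hK2'⟩ := aux_barrier hd hh₀ hT hu₀ hsol hF (ξ := h) (σ := 1) (Or.inl rfl)
    hsol.h_reg (by rw [hsol.h_init]; constructor <;> linarith) (by rw [hsol.h_init]; exact hu₀.2.2.1)
    (fun t ht x hx => by linarith [hx.2])
  have hrng : ∀ t x, auxExt T u g h t x ∈ Icc 0 M0 := fun t x =>
    ⟨hpos _ (auxClamp_mem hT t) _ (aux_clampx_mem hT hsol t x),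
      (le_abs_self _).trans (hbd _ (auxClamp_mem hT t) _ (aux_clampx_mem hT hsol t x))⟩
  refine ⟨M0, hM0, max K1 K2, hK1.trans (le_max_left _ _), fun M hM K hK => ?_⟩
  have hK0 : 0 ≤ K := hK1.trans ((le_max_left _ _).trans hK)
  have hFc := auxF_cont (T := T) hf2 hT hM0 (auxExt_cont hT hsol) hrng
  refine ⟨auxExt_cont hT hsol, hsol.g_reg.continuousOn, hsol.h_reg.continuousOn, hsol.g_lt_h,
    fun t x => ⟨(hrng t x).1, (hrng t x).2.trans hM⟩, aux_dataU hsol, ?_, ?_, hFc, ?_⟩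
  · intro t ht x
    have htI : t ∈ Icc 0 T := ⟨ht.1, ht.2.le⟩
    have hnn : 0 ≤ K * max (x - g t) 0 := mul_nonneg hK0 (le_max_right _ _)
    rcases le_total x (g t) with h1 | h1
    · rw [auxExt_left hsol hu₀ hh₀ htI h1]; simpa using hnn
    rcases le_total (h t) x with h2 | h2
    · rw [auxExt_right hsol hu₀ hh₀ htI h2]; simpa using hnn
    rw [auxExt_eq htI ⟨h1, h2⟩]
    refine (hK1' t ht x ⟨h1, h2⟩).trans ?_
    rw [abs_sub_comm, abs_of_nonneg (by linarith), max_eq_left (by linarith)]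
    exact mul_le_mul_of_nonneg_right ((le_max_left _ _).trans hK) (by linarith)
  · intro t ht x
    have htI : t ∈ Icc 0 T := ⟨ht.1, ht.2.le⟩
    have hnn : 0 ≤ K * max (h t - x) 0 := mul_nonneg hK0 (le_max_right _ _)
    rcases le_total x (g t) with h1 | h1
    · rw [auxExt_left hsol hu₀ hh₀ htI h1]; simpa using hnn
    rcases le_total (h t) x with h2 | h2
    · rw [auxExt_right hsol hu₀ hh₀ htI h2]; simpa using hnn
    rw [auxExt_eq htI ⟨h1, h2⟩]
    refine (hK2' t ht x ⟨h1, h2⟩).trans ?_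
    rw [abs_of_nonneg (by linarith), max_eq_left (by linarith)]
    exact mul_le_mul_of_nonneg_right ((le_max_right _ _).trans hK) (by linarith)
  · intro s0 s1 a ξ hξ h0 h1 ha
    refine aux_mass_deriv (Fh := fun t y => f (auxClamp T t) y (auxExt T u g h t y))
      hδ hT hh₀ hu₀ hsol hFc ?_ hξ h0 h1 ha
    intro t ht x hx
    rw [auxClamp_eq ht, auxExt_eq ht hx]

end build

/-- exponential weight -/
noncomputable def auxTheta (k gs hs x : ℝ) : ℝ :=
  Real.exp (k * (x - hs) + 1) + Real.exp (k * (gs - x) + 1)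

lemma auxTheta_pos (k gs hs x : ℝ) : 0 < auxTheta k gs hs x := by unfold auxTheta; positivity

lemma auxTheta_cont (k gs hs : ℝ) : Continuous (auxTheta k gs hs) := by unfold auxTheta; fun_prop

lemma auxTheta_deriv1 (k gs hs x : ℝ) : HasDerivAt (auxTheta k gs hs)
    (k * Real.exp (k * (x - hs) + 1) - k * Real.exp (k * (gs - x) + 1)) x := by
  unfold auxTheta
  have h1 : HasDerivAt (fun x : ℝ => k * (x - hs) + 1) k x := by
    simpa using (((hasDerivAt_id x).sub_const hs).const_mul k).add_const 1
  have h2 : HasDerivAt (fun x : ℝ => k * (gs - x) + 1) (-k) x := by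
    simpa using (((hasDerivAt_id x).const_sub gs).const_mul k).add_const 1
  exact (h1.exp.add h2.exp).congr_deriv (by ring)

lemma auxTheta_deriv2 (k gs hs x : ℝ) : HasDerivAt
    (fun x => k * Real.exp (k * (x - hs) + 1) - k * Real.exp (k * (gs - x) + 1))
    (k ^ 2 * auxTheta k gs hs x) x := by
  unfold auxTheta
  have h1 : HasDerivAt (fun x : ℝ => k * (x - hs) + 1) k x := by
    simpa using (((hasDerivAt_id x).sub_const hs).const_mul k).add_const 1
  have h2 : HasDerivAt (fun x : ℝ => k * (gs - x) + 1) (-k) x := by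
    simpa using (((hasDerivAt_id x).const_sub gs).const_mul k).add_const 1
  exact ((h1.exp.const_mul k).sub (h2.exp.const_mul k)).congr_deriv (by ring)

lemma auxTheta_int {k gs hs : ℝ} (hk : 0 < k) (X : ℝ) :
    ∫ x in ((gs + hs) / 2)..X, auxTheta k gs hs x
      = (Real.exp (k * (X - hs) + 1) - Real.exp (k * (gs - X) + 1)) / k := by
  rw [intervalIntegral.integral_eq_sub_of_hasDerivAt
    (f := fun x => (Real.exp (k * (x - hs) + 1) - Real.exp (k * (gs - x) + 1)) / k)
    (fun x _ => ?_) ((auxTheta_cont k gs hs).intervalIntegrable _ _)]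
  · have : k * ((gs + hs) / 2 - hs) + 1 = k * (gs - (gs + hs) / 2) + 1 := by ring
    rw [this]; ring
  · unfold auxTheta
    have h1 : HasDerivAt (fun x : ℝ => k * (x - hs) + 1) k x := by
      simpa using (((hasDerivAt_id x).sub_const hs).const_mul k).add_const 1
    have h2 : HasDerivAt (fun x : ℝ => k * (gs - x) + 1) (-k) x := by
      simpa using (((hasDerivAt_id x).const_sub gs).const_mul k).add_const 1
    refine ((h1.exp.sub h2.exp).div_const k).congr_deriv ?_
    field_simp; ring

lemma auxTheta_int_le {k gs hs X : ℝ} (hk : 0 < k) (h1 : X ≤ hs + 1 / k) (h2 : gs - 1 / k ≤ X) :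
    |∫ x in ((gs + hs) / 2)..X, auxTheta k gs hs x| ≤ Real.exp 2 / k := by
  rw [auxTheta_int hk, abs_div, abs_of_pos hk]
  refine div_le_div_of_nonneg_right ?_ hk.le
  have e1 : k * (X - hs) + 1 ≤ 2 := by
    have : k * (X - hs) ≤ k * (1 / k) := mul_le_mul_of_nonneg_left (by linarith) hk.le
    rw [mul_one_div_cancel hk.ne'] at this; linarith
  have e2 : k * (gs - X) + 1 ≤ 2 := by
    have : k * (gs - X) ≤ k * (1 / k) := mul_le_mul_of_nonneg_left (by linarith) hk.le
    rw [mul_one_div_cancel hk.ne'] at this; linarith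
  have := Real.exp_le_exp.2 e1
  have := Real.exp_le_exp.2 e2
  have := Real.exp_pos (k * (X - hs) + 1)
  have := Real.exp_pos (k * (gs - X) + 1)
  rw [abs_le]; constructor <;> linarith

lemma auxTheta_le {k gs hs X : ℝ} (hk : 0 < k) (h1 : X ≤ hs + 1 / k) (h2 : gs - 1 / k ≤ X) :
    auxTheta k gs hs X ≤ 2 * Real.exp 2 := by
  have e1 : k * (X - hs) + 1 ≤ 2 := by
    have : k * (X - hs) ≤ k * (1 / k) := mul_le_mul_of_nonneg_left (by linarith) hk.le
    rw [mul_one_div_cancel hk.ne'] at this; linarith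
  have e2 : k * (gs - X) + 1 ≤ 2 := by
    have : k * (gs - X) ≤ k * (1 / k) := mul_le_mul_of_nonneg_left (by linarith) hk.le
    rw [mul_one_div_cancel hk.ne'] at this; linarith
  have := Real.exp_le_exp.2 e1
  have := Real.exp_le_exp.2 e2
  unfold auxTheta; linarith

lemma auxTheta_ge {k gs hs X : ℝ} (hk : 0 < k) (h1 : hs - 1 / k ≤ X ∨ X ≤ gs + 1 / k) :
    1 ≤ auxTheta k gs hs X := by
  unfold auxTheta
  have p1 := Real.exp_pos (k * (X - hs) + 1)
  have p2 := Real.exp_pos (k * (gs - X) + 1)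
  rcases h1 with h1 | h1
  · have : k * (-(1 / k)) ≤ k * (X - hs) := mul_le_mul_of_nonneg_left (by linarith) hk.le
    rw [mul_neg, mul_one_div_cancel hk.ne'] at this
    have := Real.one_le_exp (by linarith : 0 ≤ k * (X - hs) + 1)
    linarith
  · have : k * (-(1 / k)) ≤ k * (gs - X) := mul_le_mul_of_nonneg_left (by linarith) hk.le
    rw [mul_neg, mul_one_div_cancel hk.ne'] at this
    have := Real.one_le_exp (by linarith : 0 ≤ k * (gs - X) + 1)
    linarith

section cmp
variable {d δ T K M L : ℝ} {f : ℝ → ℝ → ℝ → ℝ} {U₁ U₂ : ℝ → ℝ → ℝ} {g₁ h₁ g₂ h₂ : ℝ → ℝ}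

lemma aux_outside (hK : 0 ≤ K) (P₁ : AuxP d δ T K M f U₁ g₁ h₁) (P₂ : AuxP d δ T K M f U₂ g₂ h₂)
    {t E x : ℝ} (ht : t ∈ Ico 0 T) (hE : 0 ≤ E) (hEg : |g₁ t - g₂ t| ≤ E) (hEh : |h₁ t - h₂ t| ≤ E)
    (hx : x ≤ max (g₁ t) (g₂ t) ∨ min (h₁ t) (h₂ t) ≤ x) :
    |U₁ t x - U₂ t x| ≤ K * E := by
  have a1 := P₁.lipg t ht x
  have a2 := P₂.lipg t ht x
  have b1 := P₁.liph t ht x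
  have b2 := P₂.liph t ht x
  have z : ∀ v w c e : ℝ, |v - δ| ≤ K * max c 0 → |w - δ| ≤ K * max e 0 → c ≤ 0 → e ≤ E →
      |v - w| ≤ K * E := by
    intro v w c e h1 h2 h3 h4
    rw [max_eq_right h3, mul_zero] at h1
    have h5 : v - δ = 0 := abs_eq_zero.1 (le_antisymm h1 (abs_nonneg _))
    have h6 : v - w = -(w - δ) := by linarith
    rw [h6, abs_neg]
    exact h2.trans (mul_le_mul_of_nonneg_left (max_le h4 hE) hK)
  have eg := abs_le.1 hEg
  have eh := abs_le.1 hEh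
  rcases hx with hx | hx
  · rcases le_max_iff.1 hx with h | h
    · exact z _ _ _ _ a1 a2 (by linarith) (by linarith)
    · rw [abs_sub_comm]; exact z _ _ _ _ a2 a1 (by linarith) (by linarith)
  · rcases min_le_iff.1 hx with h | h
    · exact z _ _ _ _ b1 b2 (by linarith) (by linarith)
    · rw [abs_sub_comm]; exact z _ _ _ _ b2 b1 (by linarith) (by linarith)

lemma aux_compare_half (hd : 0 < d) (hK : 0 ≤ K) (hL : 0 ≤ L)
    (hLip : ∀ t ∈ Ici (0:ℝ), ∀ x : ℝ, ∀ v₁ ∈ Icc (0:ℝ) M, ∀ v₂ ∈ Icc (0:ℝ) M,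
        |f t x v₁ - f t x v₂| ≤ L * |v₁ - v₂|)
    (P₁ : AuxP d δ T K M f U₁ g₁ h₁) (P₂ : AuxP d δ T K M f U₂ g₂ h₂)
    {t0 t1 E k gs hs : ℝ} (ht0 : 0 ≤ t0) (ht1 : t1 < T) (hE : 0 ≤ E)
    (hEg : ∀ t ∈ Icc t0 t1, |g₁ t - g₂ t| ≤ E) (hEh : ∀ t ∈ Icc t0 t1, |h₁ t - h₂ t| ≤ E)
    (hi : ∀ x, U₁ t0 x = U₂ t0 x) (hk : 0 < k)
    (hg : ∀ t ∈ Icc t0 t1, g₁ t ≤ gs + 1 / k ∧ g₂ t ≤ gs + 1 / k)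
    (hh : ∀ t ∈ Icc t0 t1, hs - 1 / k ≤ h₁ t ∧ hs - 1 / k ≤ h₂ t)
    (hτ : (L + d * k ^ 2) * (t1 - t0) ≤ 2) :
    ∀ t ∈ Icc t0 t1, ∀ x, U₁ t x - U₂ t x ≤ K * E * Real.exp 2 * auxTheta k gs hs x := by
  have hΛ : 0 ≤ L + d * k ^ 2 := by positivity
  have hKE : 0 ≤ K * E := mul_nonneg hK hE
  have hsub : Icc t0 t1 ⊆ Icc 0 T := Icc_subset_Icc ht0 ht1.le
  have hθ : ∀ t ∈ Icc t0 t1, ∀ x, (x ≤ max (g₁ t) (g₂ t) ∨ min (h₁ t) (h₂ t) ≤ x) →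
      1 ≤ auxTheta k gs hs x := by
    intro t ht x hx
    refine auxTheta_ge hk ?_
    rcases hx with hx | hx
    · exact Or.inr (hx.trans (max_le (hg t ht).1 (hg t ht).2))
    · exact Or.inl ((le_min (hh t ht).1 (hh t ht).2).trans hx)
  have hout : ∀ t ∈ Icc t0 t1, ∀ x, (x ≤ max (g₁ t) (g₂ t) ∨ min (h₁ t) (h₂ t) ≤ x) →
      0 ≤ K * E * Real.exp ((L + d * k ^ 2) * (t - t0)) * auxTheta k gs hs x
        - (U₁ t x - U₂ t x) := by
    intro t ht x hx
    have e1 := (le_abs_self _).trans (aux_outside hK P₁ P₂ ⟨ht0.trans ht.1, ht.2.trans_lt ht1⟩ hE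
      (hEg t ht) (hEh t ht) hx)
    have e2 := hθ t ht x hx
    have e3 : 1 ≤ Real.exp ((L + d * k ^ 2) * (t - t0)) :=
      Real.one_le_exp (mul_nonneg hΛ (by linarith [ht.1]))
    have e4 : K * E * 1 ≤ K * E * (Real.exp ((L + d * k ^ 2) * (t - t0)) * auxTheta k gs hs x) :=
      mul_le_mul_of_nonneg_left (one_le_mul_of_one_le_of_one_le e3 e2) hKE
    linarith
  have mp := aux_max_principle (d := d) (L := L) (t0 := t0) (t1 := t1)
    (γ := fun t => max (g₁ t) (g₂ t)) (η := fun t => min (h₁ t) (h₂ t))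
    (w := fun t x => K * E * Real.exp ((L + d * k ^ 2) * (t - t0)) * auxTheta k gs hs x
        - (U₁ t x - U₂ t x)) hd
    ((P₁.gc.mono hsub).sup (P₂.gc.mono hsub)) ((P₁.hc.mono hsub).inf (P₂.hc.mono hsub))
    (by
      have c1 := auxTheta_cont k gs hs
      have c2 := P₁.Uc
      have c3 := P₂.Uc
      exact Continuous.continuousOn (by fun_prop))
    (by
      intro x _
      simp only [hi x, sub_self, sub_zero]
      have := auxTheta_pos k gs hs x
      positivity)
    (fun t ht _ => hout t ht _ (Or.inl le_rfl))
    (fun t ht _ => hout t ht _ (Or.inr le_rfl))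
    (by
      intro t ht x hx hneg
      have htT : t ∈ Ioo 0 T := ⟨ht0.trans_lt ht.1, ht.2.trans_lt ht1⟩
      obtain ⟨a1, a2⟩ := max_lt_iff.1 hx.1
      obtain ⟨b1, b2⟩ := lt_min_iff.1 hx.2
      obtain ⟨ut₁, uxx₁, ux₁, p1, p2, p3, p4⟩ := P₁.data t htT x ⟨a1, b1⟩
      obtain ⟨ut₂, uxx₂, ux₂, q1, q2, q3, q4⟩ := P₂.data t htT x ⟨a2, b2⟩
      set e := Real.exp ((L + d * k ^ 2) * (t - t0)) with he
      have hexp : HasDerivAt (fun s => Real.exp ((L + d * k ^ 2) * (s - t0)))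
          (e * (L + d * k ^ 2)) t := by
        have : HasDerivAt (fun s => (L + d * k ^ 2) * (s - t0)) (L + d * k ^ 2) t := by
          simpa using ((hasDerivAt_id t).sub_const t0).const_mul (L + d * k ^ 2)
        exact this.exp
      refine ⟨K * E * (e * (L + d * k ^ 2)) * auxTheta k gs hs x - (ut₁ - ut₂),
        K * E * e * (k ^ 2 * auxTheta k gs hs x) - (uxx₁ - uxx₂),
        fun y => K * E * e * (k * Real.exp (k * (y - hs) + 1) - k * Real.exp (k * (gs - y) + 1))
          - (ux₁ y - ux₂ y), ?_, ?_, ?_, ?_⟩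
      · exact ((hexp.const_mul (K * E)).mul_const _).sub (p1.sub q1)
      · filter_upwards [p2, q2] with y hy1 hy2
        exact ((auxTheta_deriv1 k gs hs y).const_mul (K * E * e)).sub (hy1.sub hy2)
      · exact ((auxTheta_deriv2 k gs hs x).const_mul (K * E * e)).sub (p3.sub q3)
      · have hl := hLip t htT.1.le x (U₁ t x) (P₁.rng t x) (U₂ t x) (P₂.rng t x)
        have hp : 0 ≤ K * E * e * auxTheta k gs hs x := by
          have := auxTheta_pos k gs hs x
          positivity
        rw [abs_of_nonneg (by linarith : 0 ≤ U₁ t x - U₂ t x)] at hl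
        have hl2 := (le_abs_self _).trans hl
        rw [p4, q4]
        nlinarith)
  intro t ht x
  have hfin : 0 ≤ K * E * Real.exp ((L + d * k ^ 2) * (t - t0)) * auxTheta k gs hs x
        - (U₁ t x - U₂ t x) := by
    by_cases hx : x ≤ max (g₁ t) (g₂ t) ∨ min (h₁ t) (h₂ t) ≤ x
    · exact hout t ht x hx
    · push Not at hx
      exact mp t ht x ⟨hx.1.le, hx.2.le⟩
  have e1 : Real.exp ((L + d * k ^ 2) * (t - t0)) ≤ Real.exp 2 := by
    refine Real.exp_le_exp.2 (le_trans ?_ hτ)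
    exact mul_le_mul_of_nonneg_left (by linarith [ht.2]) hΛ
  have e2 := mul_le_mul_of_nonneg_right (mul_le_mul_of_nonneg_left e1 hKE) (auxTheta_pos k gs hs x).le
  linarith

lemma aux_compare (hd : 0 < d) (hK : 0 ≤ K) (hL : 0 ≤ L)
    (hLip : ∀ t ∈ Ici (0:ℝ), ∀ x : ℝ, ∀ v₁ ∈ Icc (0:ℝ) M, ∀ v₂ ∈ Icc (0:ℝ) M,
        |f t x v₁ - f t x v₂| ≤ L * |v₁ - v₂|)
    (P₁ : AuxP d δ T K M f U₁ g₁ h₁) (P₂ : AuxP d δ T K M f U₂ g₂ h₂)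
    {t0 t1 E k gs hs : ℝ} (ht0 : 0 ≤ t0) (ht1 : t1 < T) (hE : 0 ≤ E)
    (hEg : ∀ t ∈ Icc t0 t1, |g₁ t - g₂ t| ≤ E) (hEh : ∀ t ∈ Icc t0 t1, |h₁ t - h₂ t| ≤ E)
    (hi : ∀ x, U₁ t0 x = U₂ t0 x) (hk : 0 < k)
    (hg : ∀ t ∈ Icc t0 t1, g₁ t ≤ gs + 1 / k ∧ g₂ t ≤ gs + 1 / k)
    (hh : ∀ t ∈ Icc t0 t1, hs - 1 / k ≤ h₁ t ∧ hs - 1 / k ≤ h₂ t)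
    (hτ : (L + d * k ^ 2) * (t1 - t0) ≤ 2) :
    ∀ t ∈ Icc t0 t1, ∀ x, |U₁ t x - U₂ t x| ≤ K * E * Real.exp 2 * auxTheta k gs hs x := by
  intro t ht x
  have h1 := aux_compare_half hd hK hL hLip P₁ P₂ ht0 ht1 hE hEg hEh hi hk hg hh hτ t ht x
  have h2 := aux_compare_half hd hK hL hLip P₂ P₁ ht0 ht1 hE
    (fun t ht => by rw [abs_sub_comm]; exact hEg t ht)
    (fun t ht => by rw [abs_sub_comm]; exact hEh t ht) (fun x => (hi x).symm) hk
    (fun t ht => (hg t ht).symm) (fun t ht => (hh t ht).symm) hτ t ht x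
  rw [abs_le]; constructor <;> linarith

end cmp

lemma aux_mass_id {U : ℝ → ℝ} {δ a ξ X : ℝ} (hU : Continuous U) (hδ : ∀ y ∈ uIcc ξ X, U y = δ) :
    ∫ y in a..ξ, U y * (y - a) = (∫ y in a..X, (U y - δ) * (y - a)) + δ * (ξ - a) ^ 2 / 2 := by
  have c1 : Continuous (fun y => (U y - δ) * (y - a)) := by fun_prop
  have c2 : Continuous (fun y : ℝ => δ * (y - a)) := by fun_prop
  have e1 : ∫ y in ξ..X, (U y - δ) * (y - a) = 0 := by
    rw [intervalIntegral.integral_congr (g := fun _ => (0:ℝ)) (fun y hy => by simp [hδ y hy])]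
    simp
  have e2 : ∫ y in a..ξ, δ * (y - a) = δ * (ξ - a) ^ 2 / 2 := by
    rw [intervalIntegral.integral_eq_sub_of_hasDerivAt (f := fun y => δ * (y - a) ^ 2 / 2)
      (fun y _ => ?_) (c2.intervalIntegrable _ _)]
    · ring
    · have := ((((hasDerivAt_id y).sub_const a).pow 2).const_mul δ).div_const 2
      refine this.congr_deriv ?_
      simp; ring
  rw [← intervalIntegral.integral_add_adjacent_intervals (c1.intervalIntegrable a ξ)
    (c1.intervalIntegrable ξ X), e1, add_zero, ← e2,
    ← intervalIntegral.integral_add (c1.intervalIntegrable _ _) (c2.intervalIntegrable _ _)]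
  apply intervalIntegral.integral_congr
  intro y _
  simp only; ring

section massdiff
variable {d δ T K M L : ℝ} {f : ℝ → ℝ → ℝ → ℝ} {U₁ U₂ : ℝ → ℝ → ℝ} {g₁ h₁ g₂ h₂ : ℝ → ℝ}

lemma aux_mass_diff (hd : 0 < d) (hδ : 0 < δ) (hK : 0 ≤ K) (hL : 0 ≤ L) (hM : 0 ≤ M)
    (hf0 : ∀ t ∈ Ici (0:ℝ), ∀ x : ℝ, f t x 0 = 0)
    (hLip : ∀ t ∈ Ici (0:ℝ), ∀ x : ℝ, ∀ v₁ ∈ Icc (0:ℝ) M, ∀ v₂ ∈ Icc (0:ℝ) M,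
        |f t x v₁ - f t x v₂| ≤ L * |v₁ - v₂|)
    (P₁ : AuxP d δ T K M f U₁ g₁ h₁) (P₂ : AuxP d δ T K M f U₂ g₂ h₂)
    {t0 t1 E k gs hs ℓ a X σ : ℝ} {ξ₁ ξ₂ : ℝ → ℝ} (ht0 : 0 ≤ t0) (ht1 : t1 < T) (hE : 0 ≤ E)
    (hk : 0 < k) (hℓ : 0 < ℓ) (ha : a = (gs + hs) / 2) (hlen : hs - gs = 2 * ℓ)
    (hkℓ : 1 / k ≤ ℓ / 2)
    (hi : ∀ x, U₁ t0 x = U₂ t0 x) (hξ0 : ξ₁ t0 = ξ₂ t0)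
    (hξ₁ : ξ₁ = g₁ ∨ ξ₁ = h₁) (hξ₂ : ξ₂ = g₂ ∨ ξ₂ = h₂)
    (ha₁ : ∀ t ∈ Icc t0 t1, a ∈ Ioo (g₁ t) (h₁ t)) (ha₂ : ∀ t ∈ Icc t0 t1, a ∈ Ioo (g₂ t) (h₂ t))
    (hEξ : ∀ t ∈ Icc t0 t1, |ξ₁ t - ξ₂ t| ≤ E)
    (hX : X ∈ Icc (gs - 1 / k) (hs + 1 / k))
    (hr₁ : ∀ t ∈ Icc t0 t1, ξ₁ t ∈ Icc (gs - 1 / k) (hs + 1 / k))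
    (hr₂ : ∀ t ∈ Icc t0 t1, ξ₂ t ∈ Icc (gs - 1 / k) (hs + 1 / k))
    (hσ : |σ| = 1) (hs₁ : ∀ t ∈ Icc t0 t1, ℓ / 2 ≤ σ * (ξ₁ t - a))
    (hs₂ : ∀ t ∈ Icc t0 t1, ℓ / 2 ≤ σ * (ξ₂ t - a))
    (hX₁ : ∀ t ∈ Icc t0 t1, ∀ y ∈ uIcc (ξ₁ t) X, U₁ t y = δ)
    (hX₂ : ∀ t ∈ Icc t0 t1, ∀ y ∈ uIcc (ξ₂ t) X, U₂ t y = δ)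
    (hcmp : ∀ t ∈ Icc t0 t1, ∀ x, |U₁ t x - U₂ t x| ≤ K * E * Real.exp 2 * auxTheta k gs hs x) :
    ∀ t ∈ Icc t0 t1, |ξ₁ t - ξ₂ t| * (ℓ * δ / 2) ≤
      (2 * ℓ * K * Real.exp 2 * (Real.exp 2 / k)) * E
      + (d * (K * Real.exp 2 * (2 * Real.exp 2))
        + L * (K * Real.exp 2 * (2 * Real.exp 2)) * (2 * ℓ) * (2 * ℓ) + L * M * (2 * ℓ))
        * E * (t1 - t0) := by
  set D := K * E * Real.exp 2 * (2 * Real.exp 2) with hD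
  have hD0 : 0 ≤ D := by positivity
  have hk0 : 0 < 1 / k := by positivity
  have haI : a ∈ Icc (gs - 1 / k) (hs + 1 / k) := by
    constructor <;> rw [ha] <;> linarith
  have hR : ∀ y ∈ Icc (gs - 1 / k) (hs + 1 / k), |y - a| ≤ 2 * ℓ := by
    intro y hy
    rw [abs_le]; constructor <;> rw [ha] <;> linarith [hy.1, hy.2]
  have hDb : ∀ t ∈ Icc t0 t1, ∀ y ∈ Icc (gs - 1 / k) (hs + 1 / k), |U₁ t y - U₂ t y| ≤ D := by
    intro t ht y hy
    refine (hcmp t ht y).trans ?_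
    exact mul_le_mul_of_nonneg_left (auxTheta_le hk hy.2 hy.1) (by positivity)
  have hsubI : ∀ b ∈ Icc (gs - 1 / k) (hs + 1 / k), ∀ c ∈ Icc (gs - 1 / k) (hs + 1 / k),
      ∀ y ∈ uIoc b c, y ∈ Icc (gs - 1 / k) (hs + 1 / k) := by
    intro b hb c hc y hy
    exact uIcc_subset_Icc hb hc (uIoc_subset_uIcc hy)
  have hsl : ∀ {V : ℝ → ℝ → ℝ} (_ : Continuous (fun p : ℝ × ℝ => V p.1 p.2)) (t : ℝ),
      Continuous (V t) := fun hV t => hV.comp (by fun_prop : Continuous fun y : ℝ => (t, y))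
  set J : ℝ → ℝ := fun t => (∫ y in a..ξ₁ t, U₁ t y * (y - a)) - ∫ y in a..ξ₂ t, U₂ t y * (y - a)
    with hJ
  have hJe : ∀ t ∈ Icc t0 t1, J t = ((∫ y in a..X, (U₁ t y - δ) * (y - a))
      - ∫ y in a..X, (U₂ t y - δ) * (y - a))
      + δ / 2 * ((ξ₁ t - a) ^ 2 - (ξ₂ t - a) ^ 2) := by
    intro t ht
    simp only [hJ]
    rw [aux_mass_id (hsl P₁.Uc t) (hX₁ t ht), aux_mass_id (hsl P₂.Uc t) (hX₂ t ht)]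
    ring
  have hsub : Icc t0 t1 ⊆ Icc 0 T := Icc_subset_Icc ht0 ht1.le
  have hc₁ : ContinuousOn ξ₁ (Icc t0 t1) := by
    rcases hξ₁ with rfl | rfl
    exacts [P₁.gc.mono hsub, P₁.hc.mono hsub]
  have hc₂ : ContinuousOn ξ₂ (Icc t0 t1) := by
    rcases hξ₂ with rfl | rfl
    exacts [P₂.gc.mono hsub, P₂.hc.mono hsub]
  have hpar : ∀ {V : ℝ → ℝ → ℝ} (_ : Continuous (fun p : ℝ × ℝ => V p.1 p.2)),
      Continuous (fun t => ∫ y in a..X, (V t y - δ) * (y - a)) := by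
    intro V hV
    apply intervalIntegral.continuous_parametric_intervalIntegral_of_continuous'
      (f := fun t y => (V t y - δ) * (y - a))
    exact (hV.sub continuous_const).mul (by fun_prop)
  have hJc : ContinuousOn J (Icc t0 t1) := by
    refine ContinuousOn.congr (f := fun t => ((∫ y in a..X, (U₁ t y - δ) * (y - a))
      - ∫ y in a..X, (U₂ t y - δ) * (y - a))
      + δ / 2 * ((ξ₁ t - a) ^ 2 - (ξ₂ t - a) ^ 2)) ?_ hJe
    refine ((hpar P₁.Uc).sub (hpar P₂.Uc)).continuousOn.add (continuousOn_const.mul ?_)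
    exact ((hc₁.sub continuousOn_const).pow 2).sub ((hc₂.sub continuousOn_const).pow 2)
  set C := d * D + L * D * (2 * ℓ) * (2 * ℓ) + L * M * (2 * ℓ) * E with hC
  have hC0 : 0 ≤ C := by positivity
  have hIoo : Ioo t0 t1 ⊆ Icc t0 t1 := Ioo_subset_Icc_self
  -- the derivative bound
  have hder : ∀ t ∈ Ioo t0 t1, ∃ J', HasDerivAt J J' t ∧ |J'| ≤ C := by
    intro t ht
    have htI := hIoo ht
    have m1 := P₁.mass t0 t1 a ξ₁ hξ₁ ht0 ht1.le (fun s hs => ha₁ s (hIoo hs)) t ht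
    have m2 := P₂.mass t0 t1 a ξ₂ hξ₂ ht0 ht1.le (fun s hs => ha₂ s (hIoo hs)) t ht
    refine ⟨_, m1.sub m2, ?_⟩
    rw [auxClamp_eq (hsub htI)]
    have hF₁ := hsl (V := fun t y => f (auxClamp T t) y (U₁ t y)) P₁.Fc t
    have hF₂ := hsl (V := fun t y => f (auxClamp T t) y (U₂ t y)) P₂.Fc t
    rw [auxClamp_eq (hsub htI)] at hF₁ hF₂
    have i1 : Continuous fun y => f t y (U₁ t y) * (y - a) := hF₁.mul (by fun_prop)
    have i2 : Continuous fun y => f t y (U₂ t y) * (y - a) := hF₂.mul (by fun_prop)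
    have htn : t ∈ Ici (0:ℝ) := (hsub htI).1
    have s1 : (∫ y in a..ξ₁ t, f t y (U₁ t y) * (y - a)) - ∫ y in a..ξ₂ t, f t y (U₂ t y) * (y - a)
        = (∫ y in a..ξ₁ t, (f t y (U₁ t y) - f t y (U₂ t y)) * (y - a))
          + ∫ y in ξ₂ t..ξ₁ t, f t y (U₂ t y) * (y - a) := by
      rw [← intervalIntegral.integral_add_adjacent_intervals (i2.intervalIntegrable a (ξ₁ t))
        (i2.intervalIntegrable (ξ₁ t) (ξ₂ t)), intervalIntegral.integral_symm (ξ₁ t) (ξ₂ t)]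
      have : ∫ y in a..ξ₁ t, (f t y (U₁ t y) - f t y (U₂ t y)) * (y - a)
          = (∫ y in a..ξ₁ t, f t y (U₁ t y) * (y - a)) - ∫ y in a..ξ₁ t, f t y (U₂ t y) * (y - a) := by
        rw [← intervalIntegral.integral_sub (i1.intervalIntegrable _ _) (i2.intervalIntegrable _ _)]
        simp only [sub_mul]
      rw [this]; ring
    have b1 : |∫ y in a..ξ₁ t, (f t y (U₁ t y) - f t y (U₂ t y)) * (y - a)|
        ≤ L * D * (2 * ℓ) * (2 * ℓ) := by
      rw [← Real.norm_eq_abs]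
      refine (intervalIntegral.norm_integral_le_of_norm_le_const (C := L * D * (2 * ℓ)) ?_).trans ?_
      · intro y hy
        have hy' := hsubI a haI _ (hr₁ t htI) y hy
        rw [Real.norm_eq_abs, abs_mul]
        refine mul_le_mul ?_ (hR y hy') (abs_nonneg _) (by positivity)
        exact (hLip t htn y _ (P₁.rng t y) _ (P₂.rng t y)).trans
          (mul_le_mul_of_nonneg_left (hDb t htI y hy') hL)
      · exact mul_le_mul_of_nonneg_left (hR _ (hr₁ t htI)) (by positivity)
    have b2 : |∫ y in ξ₂ t..ξ₁ t, f t y (U₂ t y) * (y - a)| ≤ L * M * (2 * ℓ) * E := by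
      rw [← Real.norm_eq_abs]
      refine (intervalIntegral.norm_integral_le_of_norm_le_const (C := L * M * (2 * ℓ)) ?_).trans ?_
      · intro y hy
        have hy' := hsubI _ (hr₂ t htI) _ (hr₁ t htI) y hy
        rw [Real.norm_eq_abs, abs_mul]
        refine mul_le_mul ?_ (hR y hy') (abs_nonneg _) (by positivity)
        have q := hLip t htn y _ (P₂.rng t y) 0 ⟨le_rfl, hM⟩
        rw [hf0 t htn, sub_zero, sub_zero, abs_of_nonneg (P₂.rng t y).1] at q
        exact q.trans (mul_le_mul_of_nonneg_left (P₂.rng t y).2 hL)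
      · exact mul_le_mul_of_nonneg_left (hEξ t htI) (by positivity)
    have b3 : |d * (U₁ t a - U₂ t a)| ≤ d * D := by
      rw [abs_mul, abs_of_pos hd]
      exact mul_le_mul_of_nonneg_left (hDb t htI a haI) hd.le
    have s2 : d * (U₁ t a - δ) + (∫ y in a..ξ₁ t, f t y (U₁ t y) * (y - a))
        - (d * (U₂ t a - δ) + ∫ y in a..ξ₂ t, f t y (U₂ t y) * (y - a))
        = d * (U₁ t a - U₂ t a) + (∫ y in a..ξ₁ t, (f t y (U₁ t y) - f t y (U₂ t y)) * (y - a))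
          + ∫ y in ξ₂ t..ξ₁ t, f t y (U₂ t y) * (y - a) := by linarith
    rw [s2]
    refine (abs_add_le _ _).trans (add_le_add ((abs_add_le _ _).trans (add_le_add b3 b1)) b2)
  have hJ0 : J t0 = 0 := by
    simp only [hJ, hξ0]
    rw [sub_eq_zero]
    apply intervalIntegral.integral_congr
    intro y _
    simp only [hi]
  have hJb : ∀ t ∈ Icc t0 t1, |J t| ≤ C * (t1 - t0) := by
    intro t ht
    rcases ht.1.eq_or_lt with h | h
    · rw [← h, hJ0, abs_zero]; exact mul_nonneg hC0 (by linarith [ht.1, ht.2])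
    choose! J' hJ' using hder
    have hs1 : Icc t0 t ⊆ Icc t0 t1 := Icc_subset_Icc le_rfl ht.2
    have hs2 : Ioo t0 t ⊆ Ioo t0 t1 := Ioo_subset_Ioo le_rfl ht.2
    obtain ⟨c, hc, hc'⟩ := exists_hasDerivAt_eq_slope J J' h (hJc.mono hs1)
      (fun s hs => (hJ' s (hs2 hs)).1)
    have hb := (hJ' c (hs2 hc)).2
    have hpos : 0 < t - t0 := by linarith
    have : J t = J' c * (t - t0) := by
      rw [hc', hJ0]; field_simp; ring
    rw [this, abs_mul, abs_of_pos hpos]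
    exact mul_le_mul hb (by linarith [ht.2]) hpos.le hC0
  intro t ht
  have hj := hJb t ht
  rw [hJe t ht] at hj
  have c₁ : Continuous (fun y => (U₁ t y - δ) * (y - a)) :=
    ((hsl P₁.Uc t).sub continuous_const).mul (by fun_prop)
  have c₂ : Continuous (fun y => (U₂ t y - δ) * (y - a)) :=
    ((hsl P₂.Uc t).sub continuous_const).mul (by fun_prop)
  have hint : |(∫ y in a..X, (U₁ t y - δ) * (y - a)) - ∫ y in a..X, (U₂ t y - δ) * (y - a)|
      ≤ (2 * ℓ * K * Real.exp 2 * (Real.exp 2 / k)) * E := by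
    rw [← intervalIntegral.integral_sub (c₁.intervalIntegrable _ _) (c₂.intervalIntegrable _ _),
      ← Real.norm_eq_abs]
    have hcθ := auxTheta_cont k gs hs
    have cθ : Continuous (fun y => (2 * ℓ * (K * E * Real.exp 2)) * auxTheta k gs hs y) := by
      fun_prop
    refine (intervalIntegral.norm_integral_le_abs_of_norm_le
      (g := fun y => (2 * ℓ * (K * E * Real.exp 2)) * auxTheta k gs hs y) ?_
      (cθ.intervalIntegrable _ _)).trans ?_
    · refine (MeasureTheory.ae_restrict_iff' measurableSet_uIoc).2 (Eventually.of_forall ?_)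
      intro y hy
      have hy' := hsubI a haI _ hX y hy
      have e : (U₁ t y - δ) * (y - a) - (U₂ t y - δ) * (y - a) = (y - a) * (U₁ t y - U₂ t y) := by
        ring
      rw [e, Real.norm_eq_abs, abs_mul, mul_assoc]
      exact mul_le_mul (hR y hy') (hcmp t ht y) (abs_nonneg _) (by positivity)
    · rw [intervalIntegral.integral_const_mul, abs_mul, abs_of_nonneg (by positivity), ha]
      calc _ ≤ 2 * ℓ * (K * E * Real.exp 2) * (Real.exp 2 / k) :=
            mul_le_mul_of_nonneg_left (auxTheta_int_le hk hX.2 hX.1) (by positivity)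
        _ = _ := by ring
  have hlow : |ξ₁ t - ξ₂ t| * (ℓ * δ / 2) ≤ |δ / 2 * ((ξ₁ t - a) ^ 2 - (ξ₂ t - a) ^ 2)| := by
    have e : δ / 2 * ((ξ₁ t - a) ^ 2 - (ξ₂ t - a) ^ 2)
        = (ξ₁ t - ξ₂ t) * ((δ / 2) * ((ξ₁ t - a) + (ξ₂ t - a))) := by ring
    rw [e, abs_mul]
    refine mul_le_mul_of_nonneg_left ?_ (abs_nonneg _)
    rw [abs_mul, abs_of_pos (by positivity : 0 < δ / 2)]
    have : ℓ ≤ |(ξ₁ t - a) + (ξ₂ t - a)| := by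
      have q := le_abs_self (σ * ((ξ₁ t - a) + (ξ₂ t - a)))
      rw [abs_mul, hσ, one_mul] at q
      linarith [hs₁ t ht, hs₂ t ht]
    nlinarith
  have htri : |δ / 2 * ((ξ₁ t - a) ^ 2 - (ξ₂ t - a) ^ 2)| ≤
      C * (t1 - t0) + (2 * ℓ * K * Real.exp 2 * (Real.exp 2 / k)) * E := by
    rw [abs_le] at hj hint ⊢
    constructor <;> linarith [hj.1, hj.2, hint.1, hint.2]
  refine (hlow.trans htri).trans (le_of_eq ?_)
  rw [hC, hD]; ring

end massdiff

section step
variable {d δ T K M L : ℝ} {f : ℝ → ℝ → ℝ → ℝ} {U₁ U₂ U : ℝ → ℝ → ℝ} {g₁ h₁ g₂ h₂ g h : ℝ → ℝ}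

lemma AuxP.left (P : AuxP d δ T K M f U g h) {t y : ℝ} (ht : t ∈ Ico 0 T) (hy : y ≤ g t) :
    U t y = δ := by
  have := P.lipg t ht y
  rw [max_eq_right (by linarith), mul_zero] at this
  have := abs_eq_zero.1 (le_antisymm this (abs_nonneg _))
  linarith

lemma AuxP.right (P : AuxP d δ T K M f U g h) {t y : ℝ} (ht : t ∈ Ico 0 T) (hy : h t ≤ y) :
    U t y = δ := by
  have := P.liph t ht y
  rw [max_eq_right (by linarith), mul_zero] at this
  have := abs_eq_zero.1 (le_antisymm this (abs_nonneg _))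
  linarith

lemma aux_small {c : ℝ} (C : ℝ) (hc : 0 < c) : ∀ᶠ τ in nhdsWithin (0:ℝ) (Ioi 0), C * τ ≤ c := by
  have h : Tendsto (fun τ : ℝ => C * τ) (nhdsWithin (0:ℝ) (Ioi 0)) (nhds (C * 0)) :=
    ((continuous_const.mul continuous_id).tendsto 0).mono_left nhdsWithin_le_nhds
  rw [mul_zero] at h
  filter_upwards [h.eventually (Iio_mem_nhds hc)] with τ hτ using le_of_lt hτ

lemma aux_close {ξ : ℝ → ℝ} (hξ : ContinuousOn ξ (Icc 0 T)) {t0 ε : ℝ} (ht0 : t0 ∈ Icc 0 T)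
    (hε : 0 < ε) : ∀ᶠ t in nhdsWithin t0 (Icc 0 T), |ξ t - ξ t0| ≤ ε := by
  filter_upwards [(hξ t0 ht0).eventually (Metric.ball_mem_nhds _ hε)] with t ht
  exact le_of_lt ht

lemma aux_step (hd : 0 < d) (hδ : 0 < δ) (hK : 0 ≤ K) (hL : 0 ≤ L) (hM : 0 ≤ M)
    (hf0 : ∀ t ∈ Ici (0:ℝ), ∀ x : ℝ, f t x 0 = 0)
    (hLip : ∀ t ∈ Ici (0:ℝ), ∀ x : ℝ, ∀ v₁ ∈ Icc (0:ℝ) M, ∀ v₂ ∈ Icc (0:ℝ) M,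
        |f t x v₁ - f t x v₂| ≤ L * |v₁ - v₂|)
    (P₁ : AuxP d δ T K M f U₁ g₁ h₁) (P₂ : AuxP d δ T K M f U₂ g₂ h₂)
    {t0 : ℝ} (ht0 : t0 ∈ Ico 0 T) (hg0 : g₁ t0 = g₂ t0) (hh0 : h₁ t0 = h₂ t0)
    (hi : ∀ x, U₁ t0 x = U₂ t0 x) :
    ∃ τ > 0, ∀ t ∈ Icc t0 (t0 + τ), g₁ t = g₂ t ∧ h₁ t = h₂ t ∧ ∀ x, U₁ t x = U₂ t x := by
  have ht0I : t0 ∈ Icc 0 T := ⟨ht0.1, ht0.2.le⟩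
  obtain ⟨gs, hgs⟩ : ∃ gs, gs = g₁ t0 := ⟨_, rfl⟩
  obtain ⟨hs, hhs⟩ : ∃ hs, hs = h₁ t0 := ⟨_, rfl⟩
  have hlt : gs < hs := by rw [hgs, hhs]; exact P₁.glt t0 ht0I
  obtain ⟨ℓ, hℓe⟩ : ∃ ℓ, ℓ = (hs - gs) / 2 := ⟨_, rfl⟩
  have hℓ : 0 < ℓ := by rw [hℓe]; linarith
  obtain ⟨k, hk1, hk2⟩ : ∃ k, 2 / ℓ ≤ k ∧ 16 * K * Real.exp 2 * Real.exp 2 / δ ≤ k :=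
    ⟨_, le_max_left _ _, le_max_right _ _⟩
  have hk : 0 < k := lt_of_lt_of_le (by positivity) hk1
  have hkℓ : 1 / k ≤ ℓ / 2 := by
    rw [div_le_iff₀ hℓ] at hk1
    rw [div_le_iff₀ hk]; linarith
  have hA : 2 * ℓ * K * Real.exp 2 * (Real.exp 2 / k) ≤ ℓ * δ / 8 := by
    rw [div_le_iff₀ hδ] at hk2
    have : 2 * ℓ * K * Real.exp 2 * (Real.exp 2 / k) = (2 * ℓ * K * Real.exp 2 * Real.exp 2) / k := by
      ring
    rw [this, div_le_iff₀ hk]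
    nlinarith
  have hk0 : 0 < 1 / k := by positivity
  obtain ⟨C2, hC2⟩ : ∃ C2, C2 = d * (K * Real.exp 2 * (2 * Real.exp 2))
        + L * (K * Real.exp 2 * (2 * Real.exp 2)) * (2 * ℓ) * (2 * ℓ) + L * M * (2 * ℓ) := ⟨_, rfl⟩
  have hcl := ((aux_close P₁.gc ht0I hk0).and (aux_close P₁.hc ht0I hk0)).and
    ((aux_close P₂.gc ht0I hk0).and (aux_close P₂.hc ht0I hk0))
  obtain ⟨ε, hε, hεs⟩ := Metric.mem_nhdsWithin_iff.1 hcl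
  obtain ⟨τ, ⟨⟨⟨τ1, τ2⟩, τ3⟩, τ4⟩, τ0⟩ := (((((aux_small (L + d * k ^ 2) two_pos).and
    (aux_small C2 (by positivity : 0 < ℓ * δ / 8))).and
    (aux_small 2 (sub_pos.2 ht0.2))).and (aux_small 2 hε)).and self_mem_nhdsWithin).exists
  have τ0' : 0 < τ := τ0
  refine ⟨τ, τ0, ?_⟩
  set t1 := t0 + τ with ht1
  have ht1T : t1 < T := by linarith
  have e10 : t1 - t0 = τ := by rw [ht1]; ring
  have hsub : Icc t0 t1 ⊆ Icc 0 T := Icc_subset_Icc ht0.1 ht1T.le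
  have hIco : ∀ t ∈ Icc t0 t1, t ∈ Ico 0 T := fun t ht => ⟨ht0.1.trans ht.1, ht.2.trans_lt ht1T⟩
  have hclose : ∀ t ∈ Icc t0 t1, (|g₁ t - gs| ≤ 1 / k ∧ |h₁ t - hs| ≤ 1 / k) ∧
      (|g₂ t - gs| ≤ 1 / k ∧ |h₂ t - hs| ≤ 1 / k) := by
    intro t ht
    have hmem : t ∈ Metric.ball t0 ε ∩ Icc 0 T := by
      refine ⟨?_, hsub ht⟩
      rw [Metric.mem_ball, Real.dist_eq, abs_of_nonneg (by linarith [ht.1])]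
      linarith [ht.2]
    have := hεs hmem
    rw [hgs, hhs]
    refine ⟨this.1, ?_⟩
    rw [hg0, hh0]; exact this.2
  have hb : ∀ t ∈ Icc t0 t1, (gs - 1 / k ≤ g₁ t ∧ g₁ t ≤ gs + 1 / k) ∧
      (hs - 1 / k ≤ h₁ t ∧ h₁ t ≤ hs + 1 / k) ∧ (gs - 1 / k ≤ g₂ t ∧ g₂ t ≤ gs + 1 / k) ∧
      (hs - 1 / k ≤ h₂ t ∧ h₂ t ≤ hs + 1 / k) := by
    intro t ht
    obtain ⟨⟨q1, q2⟩, q3, q4⟩ := hclose t ht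
    rw [abs_le] at q1 q2 q3 q4
    refine ⟨⟨?_, ?_⟩, ⟨?_, ?_⟩, ⟨?_, ?_⟩, ⟨?_, ?_⟩⟩ <;> linarith [q1.1, q1.2, q2.1, q2.2, q3.1, q3.2, q4.1, q4.2]
  clear hclose hεs hcl
  have hEc : ContinuousOn (fun t => max |g₁ t - g₂ t| |h₁ t - h₂ t|) (Icc t0 t1) :=
    (((P₁.gc.mono hsub).sub (P₂.gc.mono hsub)).abs).sup
      (((P₁.hc.mono hsub).sub (P₂.hc.mono hsub)).abs)
  obtain ⟨tm, htm, hmax⟩ := isCompact_Icc.exists_isMaxOn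
    (nonempty_Icc.2 (by linarith : t0 ≤ t1)) hEc
  obtain ⟨E, hE⟩ : ∃ E, E = max |g₁ tm - g₂ tm| |h₁ tm - h₂ tm| := ⟨_, rfl⟩
  have hEall : ∀ t ∈ Icc t0 t1, max |g₁ t - g₂ t| |h₁ t - h₂ t| ≤ E := by
    intro t ht; rw [hE]; exact hmax ht
  have hE0 : 0 ≤ E := by rw [hE]; exact (abs_nonneg _).trans (le_max_left _ _)
  have hEg : ∀ t ∈ Icc t0 t1, |g₁ t - g₂ t| ≤ E := fun t ht => (le_max_left _ _).trans (hEall t ht)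
  have hEh : ∀ t ∈ Icc t0 t1, |h₁ t - h₂ t| ≤ E := fun t ht => (le_max_right _ _).trans (hEall t ht)
  have hcmp := aux_compare hd hK hL hLip P₁ P₂ ht0.1 ht1T hE0 hEg hEh hi hk
    (gs := gs) (hs := hs) (fun t ht => ⟨(hb t ht).1.2, (hb t ht).2.2.1.2⟩)
    (fun t ht => ⟨(hb t ht).2.1.1, (hb t ht).2.2.2.1⟩) (by rw [e10]; exact τ1)
  have ha₁ : ∀ t ∈ Icc t0 t1, (gs + hs) / 2 ∈ Ioo (g₁ t) (h₁ t) := by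
    intro t ht
    have := hb t ht
    constructor <;> linarith
  have ha₂ : ∀ t ∈ Icc t0 t1, (gs + hs) / 2 ∈ Ioo (g₂ t) (h₂ t) := by
    intro t ht
    have := hb t ht
    constructor <;> linarith
  have mg := aux_mass_diff hd hδ hK hL hM hf0 hLip P₁ P₂ (ξ₁ := g₁) (ξ₂ := g₂) (ℓ := ℓ)
    (X := gs - 1 / k) (σ := -1) ht0.1 ht1T hE0 hk hℓ rfl (by rw [hℓe]; ring) hkℓ hi hg0
    (Or.inl rfl) (Or.inl rfl) ha₁ ha₂ hEg ⟨le_rfl, by linarith⟩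
    (fun t ht => ⟨(hb t ht).1.1, by linarith [(hb t ht).1.2]⟩)
    (fun t ht => ⟨(hb t ht).2.2.1.1, by linarith [(hb t ht).2.2.1.2]⟩)
    (by simp) (fun t ht => by linarith [(hb t ht).1.2]) (fun t ht => by linarith [(hb t ht).2.2.1.2])
    (fun t ht y hy => P₁.left (hIco t ht) (hy.2.trans (max_le le_rfl (hb t ht).1.1)))
    (fun t ht y hy => P₂.left (hIco t ht) (hy.2.trans (max_le le_rfl (hb t ht).2.2.1.1))) hcmp
  have mh := aux_mass_diff hd hδ hK hL hM hf0 hLip P₁ P₂ (ξ₁ := h₁) (ξ₂ := h₂) (ℓ := ℓ)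
    (X := hs + 1 / k) (σ := 1) ht0.1 ht1T hE0 hk hℓ rfl (by rw [hℓe]; ring) hkℓ hi hh0
    (Or.inr rfl) (Or.inr rfl) ha₁ ha₂ hEh ⟨by linarith, le_rfl⟩
    (fun t ht => ⟨by linarith [(hb t ht).2.1.1], (hb t ht).2.1.2⟩)
    (fun t ht => ⟨by linarith [(hb t ht).2.2.2.1], (hb t ht).2.2.2.2⟩)
    (by simp) (fun t ht => by linarith [(hb t ht).2.1.1]) (fun t ht => by linarith [(hb t ht).2.2.2.1])
    (fun t ht y hy => P₁.right (hIco t ht) ((le_min le_rfl (hb t ht).2.1.2).trans hy.1))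
    (fun t ht y hy => P₂.right (hIco t ht) ((le_min le_rfl (hb t ht).2.2.2.2).trans hy.1)) hcmp
  rw [e10, ← hC2] at mg mh
  have hrhs : 2 * ℓ * K * Real.exp 2 * (Real.exp 2 / k) * E + C2 * E * τ ≤ E / 2 * (ℓ * δ / 2) := by
    have q1 := mul_le_mul_of_nonneg_right hA hE0
    have q2 := mul_le_mul_of_nonneg_right τ2 hE0
    nlinarith
  have hpos : 0 < ℓ * δ / 2 := by positivity
  have hE1 : E ≤ E / 2 := by
    have q1 := le_of_mul_le_mul_right ((mg tm htm).trans hrhs) hpos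
    have q2 := le_of_mul_le_mul_right ((mh tm htm).trans hrhs) hpos
    calc E = _ := hE
      _ ≤ E / 2 := max_le q1 q2
  have hEz : E = 0 := by linarith
  intro t ht
  refine ⟨?_, ?_, fun x => ?_⟩
  · have := hEg t ht
    rw [hEz] at this
    exact sub_eq_zero.1 (abs_eq_zero.1 (le_antisymm this (abs_nonneg _)))
  · have := hEh t ht
    rw [hEz] at this
    exact sub_eq_zero.1 (abs_eq_zero.1 (le_antisymm this (abs_nonneg _)))
  · have := hcmp t ht x
    rw [hEz, mul_zero, zero_mul, zero_mul] at this
    exact sub_eq_zero.1 (abs_eq_zero.1 (le_antisymm this (abs_nonneg _)))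

end step

/-- uniqueness of classical solutions of problem (c). -/
theorem solution_unique (d δ h₀ T β : ℝ) (f : ℝ → ℝ → ℝ → ℝ)
    (u₀ : ℝ → ℝ) (u₁ u₂ : ℝ → ℝ → ℝ) (g₁ h₁ g₂ h₂ : ℝ → ℝ)
    (hd : 0 < d) (hδ : 0 < δ) (hh₀ : 0 < h₀) (hT : 0 < T)
    (hf2 : CondF2 f β) (hu₀ : InX δ h₀ u₀)
    (hsol₁ : ClassicalSolution d δ h₀ f u₀ (Icc 0 T) u₁ g₁ h₁)
    (hsol₂ : ClassicalSolution d δ h₀ f u₀ (Icc 0 T) u₂ g₂ h₂) :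
    ∀ t ∈ Icc (0:ℝ) T, g₁ t = g₂ t ∧ h₁ t = h₂ t ∧
      ∀ x ∈ Icc (g₁ t) (h₁ t), u₁ t x = u₂ t x := by
  obtain ⟨M1, hM1, K1, hK1, H1⟩ := auxP_of_sol hd hδ hh₀ hT hf2 hu₀ hsol₁
  obtain ⟨M2, hM2, K2, hK2, H2⟩ := auxP_of_sol hd hδ hh₀ hT hf2 hu₀ hsol₂
  have hM : 0 < max M1 M2 := lt_max_of_lt_left hM1
  have hK : 0 ≤ max K1 K2 := hK1.trans (le_max_left _ _)
  have P₁ := H1 _ (le_max_left M1 M2) _ (le_max_left K1 K2)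
  have P₂ := H2 _ (le_max_right M1 M2) _ (le_max_right K1 K2)
  obtain ⟨L, hL, hLip⟩ := hf2.2.2.2.2 _ hM
  set S : Set ℝ := {t | g₁ t = g₂ t ∧ h₁ t = h₂ t ∧
    ∀ x, auxExt T u₁ g₁ h₁ t x = auxExt T u₂ g₂ h₂ t x} with hS
  have hclosed : IsClosed (S ∩ Icc 0 T) := by
    have e : S ∩ Icc 0 T = (Icc 0 T ∩ {t | g₁ t = g₂ t}) ∩ ((Icc 0 T ∩ {t | h₁ t = h₂ t}) ∩
        ⋂ x, {t | auxExt T u₁ g₁ h₁ t x = auxExt T u₂ g₂ h₂ t x}) := by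
      ext t
      simp only [hS, mem_inter_iff, mem_ofPred_eq, mem_iInter]
      tauto
    have cl : ∀ a b : ℝ → ℝ, ContinuousOn a (Icc 0 T) → ContinuousOn b (Icc 0 T) →
        IsClosed (Icc 0 T ∩ {t | a t = b t}) := by
      intro a b ha hb
      have := (ha.sub hb).preimage_isClosed_of_isClosed isClosed_Icc (isClosed_singleton (x := (0:ℝ)))
      convert! this using 1
      ext t
      simp [sub_eq_zero]
    rw [e]
    refine (cl _ _ P₁.gc P₂.gc).inter ((cl _ _ P₁.hc P₂.hc).inter (isClosed_iInter fun x => ?_))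
    exact isClosed_eq (P₁.Uc.comp (by fun_prop : Continuous fun t : ℝ => (t, x)))
      (P₂.Uc.comp (by fun_prop : Continuous fun t : ℝ => (t, x)))
  have h0 : (0:ℝ) ∈ S := by
    have h0T : (0:ℝ) ∈ Icc 0 T := ⟨le_rfl, hT.le⟩
    refine ⟨by rw [hsol₁.g_init, hsol₂.g_init], by rw [hsol₁.h_init, hsol₂.h_init], fun x => ?_⟩
    unfold auxExt
    rw [auxClamp_eq h0T, hsol₁.g_init, hsol₂.g_init, hsol₁.h_init, hsol₂.h_init]
    have hm : max (-h₀) (min x h₀) ∈ Icc (-h₀) h₀ :=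
      ⟨le_max_left _ _, max_le (by linarith) (min_le_right _ _)⟩
    rw [hsol₁.u_init _ hm, hsol₂.u_init _ hm]
  have hall := hclosed.Icc_subset_of_forall_mem_nhdsWithin h0 (by
    rintro t ⟨⟨q1, q2, q3⟩, ht⟩
    obtain ⟨τ, hτ, hstep⟩ := aux_step hd hδ hK hL.le hM.le hf2.2.2.2.1 hLip P₁ P₂ ht q1 q2 q3
    filter_upwards [Ioo_mem_nhdsGT (by linarith : t < t + τ)] with s hs
    exact hstep s ⟨hs.1.le, hs.2.le⟩)
  intro t ht
  obtain ⟨q1, q2, q3⟩ := hall ht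
  refine ⟨q1, q2, fun x hx => ?_⟩
  have := q3 x
  rwa [auxExt_eq ht hx, auxExt_eq ht (by rw [← q1, ← q2]; exact hx)] at this
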